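/- Consider the random graph G(n,(d_i)_1^n) with degree sequence satisfying Condition 1 and i.i.d. exponential mean-1 edge weights. For a uniformly chosen vertex a and any ε > 0, P( T_a(β_n) − T_a(α_n) ≥ (1+ε) log n / (2(ν−1)) ) = o(n^{−1}) as n → ∞. -/

import Mathlib

open MeasureTheory ProbabilityTheory Filter

noncomputable section

attribute [local instance] Classical.propDecidable

namespace Flooding

instance {V : Type*} : MeasurableSpace (SimpleGraph V) := ⊤

/-- Weighted distance in a graph with edge weights `w`. -/
def distW {V : Type*} (G : SimpleGraph V) (w : Sym2 V → ℝ) (a b : V) : ℝ :=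
  sInf {x | ∃ p : G.Walk a b, x = (p.edges.map w).sum}

/-- Weighted diameter. -/
def diamW {V : Type*} (G : SimpleGraph V) (w : Sym2 V → ℝ) : ℝ :=
  sSup {x | ∃ a b : V, x = distW G w a b}

/-- Weighted flooding time from `a`. -/
def floodW {V : Type*} (G : SimpleGraph V) (w : Sym2 V → ℝ) (a : V) : ℝ :=
  sSup {x | ∃ b : V, x = distW G w a b}

/-- ball of radius t -/
def ballW {V : Type*} (G : SimpleGraph V) (w : Sym2 V → ℝ) (a : V) (t : ℝ) : Set V :=
  {b | distW G w a b ≤ t}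

/-- T_a(k), with a real threshold `k`. -/
def hitTime {V : Type*} (G : SimpleGraph V) (w : Sym2 V → ℝ) (a : V) (k : ℝ) : ℝ :=
  sInf {t | 0 ≤ t ∧ k ≤ ((ballW G w a t).ncard : ℝ)}

/-- Condition 1 of the paper. -/
structure DegreeCondition (d : ∀ n : ℕ, Fin n → ℕ) (p : ℕ → ℝ) (dmin : ℕ) : Prop where
  even_sum : ∀ n, Even (∑ i, d n i)
  nonneg : ∀ r, 0 ≤ p r
  sum_one : ∑' r, p r = 1
  tendsto_freq : ∀ r : ℕ, Tendsto
    (fun n => ((Finset.univ.filter fun i : Fin n => d n i = r).card : ℝ) / n) atTop (nhds (p r))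
  summable_mul : Summable (fun r : ℕ => (r : ℝ) * p r)
  lambda_pos : 0 < ∑' r : ℕ, (r : ℝ) * p r
  sq_bound : ∃ C : ℝ, ∀ n, (∑ i, (d n i : ℝ) ^ 2) ≤ C * n
  max_bound : ∃ τ : ℝ, 0 < τ ∧ ∃ C : ℝ, ∀ n,
    ((Finset.univ.sup (d n) : ℕ) : ℝ) ≤ C * (n : ℝ) ^ ((1 : ℝ) / 2 - τ)
  min_eq : ∀ n, 0 < n → sInf (Set.range (d n)) = dmin
  min_ge : 3 ≤ dmin
  p_dmin_pos : 0 < p dmin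

/-- λ -/
def lambdaOf (p : ℕ → ℝ) : ℝ := ∑' r : ℕ, (r : ℝ) * p r

/-- ν, the mean of the size-biased distribution q. -/
def nuOf (p : ℕ → ℝ) : ℝ := (∑' r : ℕ, (r : ℝ) * (((r : ℝ) + 1) * p (r + 1))) / lambdaOf p

/-- uniform random simple graph with degree sequence `dseq`. -/
def uniformGraph (n : ℕ) (dseq : Fin n → ℕ) : Measure (SimpleGraph (Fin n)) :=
  uniformOn {G | ∀ i, G.degree i = dseq i}

/-- i.i.d. weights on potential edges, exponential with rate `r`. -/
def weightMeasure (n : ℕ) (r : ℝ) : Measure (Sym2 (Fin n) → ℝ) :=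
  Measure.pi fun _ => expMeasure r

/-- α_n = log³ n -/
def alphaSeq (n : ℕ) : ℝ := (Real.log n) ^ 3

/-- β_n = 3 √(λ n log n/(ν−1)) -/
def betaSeq (p : ℕ → ℝ) (n : ℕ) : ℝ :=
  3 * Real.sqrt (lambdaOf p / (nuOf p - 1) * n * Real.log n)

end Flooding

namespace Flooding

/-- All simple graphs with degree sequence `d`. -/
def degGraphs {V : Type*} [Fintype V] (d : V → ℕ) : Finset (SimpleGraph V) :=
  Finset.univ.filter fun G => ∀ i, G.degree i = d i

/-- Number of neighbours of `v` in `X`. -/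
def nbrCount {V : Type*} (G : SimpleGraph V) (X : Finset V) (v : V) : ℕ :=
  (X.filter fun x => G.Adj v x).card

/-- Number of edges leaving `X`. -/
def bdry {V : Type*} [Fintype V] (G : SimpleGraph V) (X : Finset V) : ℕ :=
  ∑ v ∈ Xᶜ, nbrCount G X v

/-- `h` only depends on the subgraph induced on `X`, among the graphs with degree sequence `d`. -/
def LocalOn {V : Type*} [Fintype V] {α : Type*} (d : V → ℕ) (X : Finset V)
    (h : SimpleGraph V → α) : Prop :=
  ∀ G ∈ degGraphs d, ∀ G' ∈ degGraphs d,
    (∀ x ∈ X, ∀ y ∈ X, G.Adj x y ↔ G'.Adj x y) → h G = h G'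

section Counting

set_option linter.unusedSectionVars false

variable {V : Type*} [Fintype V]

lemma mem_degGraphs {d : V → ℕ} {G : SimpleGraph V} :
    G ∈ degGraphs d ↔ ∀ i, G.degree i = d i := by
  simp [degGraphs]

lemma degree_eq_nbrCount (G : SimpleGraph V) (v : V) :
    G.degree v = nbrCount G Finset.univ v := by
  rw [← SimpleGraph.card_neighborFinset_eq_degree, SimpleGraph.neighborFinset_eq_filter]
  rfl

lemma nbrCount_union {G : SimpleGraph V} {X Y : Finset V} (h : Disjoint X Y) (v : V) :
    nbrCount G (X ∪ Y) v = nbrCount G X v + nbrCount G Y v := by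
  unfold nbrCount
  rw [Finset.filter_union, Finset.card_union_of_disjoint]
  exact Finset.disjoint_filter_filter h

lemma nbrCount_add_compl (G : SimpleGraph V) (X : Finset V) (v : V) :
    nbrCount G X v + nbrCount G Xᶜ v = G.degree v := by
  rw [degree_eq_nbrCount, ← nbrCount_union disjoint_compl_right, Finset.union_compl]

lemma nbrCount_le_card (G : SimpleGraph V) (X : Finset V) (v : V) :
    nbrCount G X v ≤ X.card := Finset.card_filter_le _ _

lemma sum_nbrCount_comm (G : SimpleGraph V) (X Y : Finset V) :
    ∑ v ∈ Y, nbrCount G X v = ∑ x ∈ X, nbrCount G Y x := by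
  unfold nbrCount
  simp only [Finset.card_filter]
  rw [Finset.sum_comm]
  simp only [G.adj_comm]

lemma bdry_eq (G : SimpleGraph V) (X : Finset V) :
    bdry G X = ∑ x ∈ X, nbrCount G Xᶜ x := sum_nbrCount_comm G X Xᶜ

lemma bdry_add_inner (G : SimpleGraph V) (X : Finset V) :
    bdry G X + ∑ x ∈ X, nbrCount G X x = ∑ x ∈ X, G.degree x := by
  rw [bdry_eq, ← Finset.sum_add_distrib]
  exact Finset.sum_congr rfl fun x _ => by rw [add_comm, nbrCount_add_compl]

lemma bdry_le (G : SimpleGraph V) (X : Finset V) : bdry G X ≤ ∑ x ∈ X, G.degree x := by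
  rw [← bdry_add_inner]; exact Nat.le_add_right _ _

lemma nbrCount_insert {G : SimpleGraph V} {X : Finset V} {v : V} (hv : v ∉ X) (u : V) :
    nbrCount G (insert v X) u = nbrCount G X u + if G.Adj u v then 1 else 0 := by
  unfold nbrCount
  rw [Finset.filter_insert]
  split_ifs with h
  · rw [Finset.card_insert_of_notMem (by simp [hv])]
  · simp

lemma nbrCount_self (G : SimpleGraph V) (X : Finset V) (v : V) :
    nbrCount G X v = ∑ x ∈ X, if G.Adj x v then 1 else 0 := by
  unfold nbrCount
  simp only [Finset.card_filter, G.adj_comm]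

/-- Effect on the boundary of adding one vertex. -/
lemma bdry_insert (G : SimpleGraph V) {X : Finset V} {v : V} (hv : v ∉ X) :
    bdry G (insert v X) + 2 * nbrCount G X v = bdry G X + G.degree v := by
  have h1 := bdry_add_inner G (insert v X)
  have h2 := bdry_add_inner G X
  rw [Finset.sum_insert hv, Finset.sum_insert hv, nbrCount_insert hv] at h1
  have h3 : ∑ x ∈ X, nbrCount G (insert v X) x = ∑ x ∈ X, nbrCount G X x + nbrCount G X v := by
    rw [nbrCount_self G X v, ← Finset.sum_add_distrib]
    exact Finset.sum_congr rfl fun x _ => nbrCount_insert hv x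
  rw [h3] at h1
  simp at h1
  omega

lemma localOn_nbrCount (d : V → ℕ) {X : Finset V} {v : V} (hv : v ∈ X) {Y : Finset V}
    (hY : Y ⊆ X) : LocalOn d X fun G => nbrCount G Y v := by
  intro G _ G' _ h
  exact congrArg Finset.card (Finset.filter_congr fun x hx => h v hv x (hY hx))

lemma localOn_bdry (d : V → ℕ) (X : Finset V) : LocalOn d X fun G => bdry G X := by
  intro G hG G' hG' h
  have h1 := bdry_add_inner G X
  have h2 := bdry_add_inner G' X
  have h3 : ∑ x ∈ X, nbrCount G X x = ∑ x ∈ X, nbrCount G' X x :=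
    Finset.sum_congr rfl fun x hx => localOn_nbrCount d hx subset_rfl G hG G' hG' h
  have h4 : ∑ x ∈ X, G.degree x = ∑ x ∈ X, G'.degree x :=
    Finset.sum_congr rfl fun x _ => by
      rw [mem_degGraphs.1 hG, mem_degGraphs.1 hG']
  simp only
  omega

lemma LocalOn.mono {α : Type*} {d : V → ℕ} {X Y : Finset V} {h : SimpleGraph V → α}
    (hh : LocalOn d X h) (hXY : X ⊆ Y) : LocalOn d Y h :=
  fun G hG G' hG' H => hh G hG G' hG' fun x hx y hy => H x (hXY hx) y (hXY hy)

lemma LocalOn.comp {α β : Type*} {d : V → ℕ} {X : Finset V} {h : SimpleGraph V → α}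
    (hh : LocalOn d X h) (f : α → β) : LocalOn d X fun G => f (h G) :=
  fun G hG G' hG' H => congrArg f (hh G hG G' hG' H)

lemma LocalOn.comp₂ {α β γ : Type*} {d : V → ℕ} {X : Finset V} {h : SimpleGraph V → α}
    {g : SimpleGraph V → β}
    (hh : LocalOn d X h) (hg : LocalOn d X g) (f : α → β → γ) : LocalOn d X fun G => f (h G) (g G) :=
  fun G hG G' hG' H => by simp only [hh G hG G' hG' H, hg G hG G' hG' H]

/-- The four-cycle `x v z y`. -/
def fourCycle (x v z y : V) : SimpleGraph V :=
  SimpleGraph.fromEdgeSet {s(x, v), s(v, z), s(z, y), s(y, x)}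

lemma fourCycle_adj {x v z y a b : V} : (fourCycle x v z y).Adj a b ↔
    (s(a, b) = s(x, v) ∨ s(a, b) = s(v, z) ∨ s(a, b) = s(z, y) ∨ s(a, b) = s(y, x)) ∧ a ≠ b := by
  simp [fourCycle]

lemma symmDiff_adj_iff (G C : SimpleGraph V) (a b : V) :
    (symmDiff G C).Adj a b ↔ ¬ (G.Adj a b ↔ C.Adj a b) := by
  simp only [symmDiff, SimpleGraph.sup_adj, SimpleGraph.sdiff_adj]
  tauto

/-- Replacing one neighbour by another keeps the number of neighbours. -/
lemma degree_eq_of_swap {G G' : SimpleGraph V} {x p q : V} (hp : G.Adj x p) (hq : ¬ G.Adj x q)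
    (h : ∀ b, G'.Adj x b ↔ (b = q ∨ (G.Adj x b ∧ b ≠ p))) : G'.degree x = G.degree x := by
  rw [degree_eq_nbrCount, degree_eq_nbrCount]
  unfold nbrCount
  have : (Finset.univ.filter fun b => G'.Adj x b) =
      insert q ((Finset.univ.filter fun b => G.Adj x b).erase p) := by
    ext b
    simp only [Finset.mem_filter, Finset.mem_univ, true_and, Finset.mem_insert, Finset.mem_erase, h]
    tauto
  rw [this, Finset.card_insert_of_notMem (by simp [hq]),
    Finset.card_erase_add_one (by simp [hp])]

lemma switch_mem_degGraphs {d : V → ℕ} {G : SimpleGraph V} (hG : G ∈ degGraphs d)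
    {x v y z : V} (hxv : G.Adj x v) (hyz : G.Adj y z) (hxy : ¬ G.Adj x y) (hvz : ¬ G.Adj v z)
    (h1 : x ≠ y) (h2 : x ≠ z) (h3 : v ≠ y) (h4 : v ≠ z) :
    symmDiff G (fourCycle x v z y) ∈ degGraphs d := by
  rw [mem_degGraphs] at hG ⊢
  intro i
  rw [← hG i]
  have hxv' := hxv.ne
  have hyz' := hyz.ne
  by_cases hix : i = x
  · subst hix
    refine degree_eq_of_swap (p := v) (q := y) hxv hxy fun b => ?_
    rw [symmDiff_adj_iff, fourCycle_adj]
    simp only [Sym2.eq_iff]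
    grind
  by_cases hiv : i = v
  · subst hiv
    refine degree_eq_of_swap (p := x) (q := z) hxv.symm hvz fun b => ?_
    rw [symmDiff_adj_iff, fourCycle_adj]
    simp only [Sym2.eq_iff]
    have := hxv.symm
    grind
  by_cases hiy : i = y
  · subst hiy
    refine degree_eq_of_swap (p := z) (q := x) hyz (fun h => hxy h.symm) fun b => ?_
    rw [symmDiff_adj_iff, fourCycle_adj]
    simp only [Sym2.eq_iff]
    have : ¬ G.Adj i x := fun h => hxy h.symm
    grind
  by_cases hiz : i = z
  · subst hiz
    refine degree_eq_of_swap (p := y) (q := v) hyz.symm (fun h => hvz h.symm) fun b => ?_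
    rw [symmDiff_adj_iff, fourCycle_adj]
    simp only [Sym2.eq_iff]
    have : ¬ G.Adj i v := fun h => hvz h.symm
    have := hyz.symm
    grind
  · rw [degree_eq_nbrCount, degree_eq_nbrCount]
    unfold nbrCount
    congr 1
    refine Finset.filter_congr fun b _ => ?_
    rw [symmDiff_adj_iff, fourCycle_adj]
    simp only [Sym2.eq_iff]
    grind

end Counting

section Switching

set_option linter.unusedSectionVars false

variable {V : Type*} [Fintype V]

/-- Ordered edges `(y, z)` that can be used to switch away the edge `v x`. -/
def switchable (G : SimpleGraph V) (X : Finset V) (v x : V) : Finset (V × V) :=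
  Finset.univ.filter fun q => G.Adj q.1 q.2 ∧ q.1 ∉ X ∧ q.1 ≠ v ∧ q.2 ∉ X ∧ q.2 ≠ v ∧
    ¬ G.Adj x q.1 ∧ ¬ G.Adj v q.2

lemma nbrCount_switch {G : SimpleGraph V} {X : Finset V} {x v y z : V} (hx : x ∈ X)
    (hy : y ∉ X) (hz : z ∉ X) (hxv : G.Adj v x) :
    nbrCount (symmDiff G (fourCycle x v z y)) X v + 1 = nbrCount G X v := by
  unfold nbrCount
  have : (X.filter fun b => (symmDiff G (fourCycle x v z y)).Adj v b) =
      (X.filter fun b => G.Adj v b).erase x := by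
    ext b
    rw [Finset.mem_erase, Finset.mem_filter, Finset.mem_filter, symmDiff_adj_iff, fourCycle_adj]
    simp only [Sym2.eq_iff]
    have := hxv.ne
    grind
  rw [this, Finset.card_erase_add_one (by simp [hx, hxv])]

lemma switch_agree {G : SimpleGraph V} {X : Finset V} {x v y z : V}
    (hy : y ∉ X) (hv : v ∉ X) {a b : V} (ha : a ∈ X) (hb : b ∈ X) :
    G.Adj a b ↔ (symmDiff G (fourCycle x v z y)).Adj a b := by
  rw [symmDiff_adj_iff, fourCycle_adj]
  simp only [Sym2.eq_iff]
  grind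

/-- The switching inequality. -/
lemma switching (d : V → ℕ) {X : Finset V} {v : V} (hv : v ∉ X) {h : SimpleGraph V → ℝ}
    (h0 : ∀ G, 0 ≤ h G) (hloc : LocalOn d X h) {M : ℝ}
    (hM : ∀ G ∈ degGraphs d, ∀ x ∈ X, G.Adj v x → M ≤ (switchable G X v x).card) (j : ℕ) :
    (j + 1) * M * ∑ G ∈ (degGraphs d).filter (fun G => nbrCount G X v = j + 1), h G ≤
      d v * ∑ G ∈ (degGraphs d).filter (fun G => nbrCount G X v = j), bdry G X * h G := by
  let A : Finset (SimpleGraph V × V × V × V) := Finset.univ.filter fun q =>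
    q.1 ∈ degGraphs d ∧ nbrCount q.1 X v = j + 1 ∧ q.2.1 ∈ X ∧ q.1.Adj v q.2.1 ∧
      (q.2.2.1, q.2.2.2) ∈ switchable q.1 X v q.2.1
  let B : Finset (SimpleGraph V × V × V × V) := Finset.univ.filter fun q =>
    q.1 ∈ degGraphs d ∧ nbrCount q.1 X v = j ∧ q.2.1 ∈ X ∧ q.2.2.1 ∉ X ∧ q.1.Adj q.2.1 q.2.2.1 ∧
      q.1.Adj v q.2.2.2
  let φ : SimpleGraph V × V × V × V → SimpleGraph V × V × V × V := fun q =>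
    (symmDiff q.1 (fourCycle q.2.1 v q.2.2.2 q.2.2.1), q.2)
  have hφ : ∀ q ∈ A, φ q ∈ B ∧ h (φ q).1 = h q.1 := by
    rintro ⟨G, x, y, z⟩ hq
    simp only [A, switchable, Finset.mem_filter, Finset.mem_univ, true_and] at hq
    obtain ⟨hG, hj, hx, hvx, hyz, hy, hyv, hz, hzv, hxy, hvz⟩ := hq
    have hxy' : x ≠ y := fun e => hy (e ▸ hx)
    have hxz' : x ≠ z := fun e => hz (e ▸ hx)
    have hmem := switch_mem_degGraphs hG hvx.symm hyz hxy hvz hxy' hxz' hyv.symm hzv.symm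
    refine ⟨?_, (hloc _ hG _ hmem fun a ha b hb => switch_agree hy hv ha hb).symm⟩
    simp only [B, φ, Finset.mem_filter, Finset.mem_univ, true_and]
    refine ⟨hmem, ?_, hx, hy, ?_, ?_⟩
    · have := nbrCount_switch hx hy hz hvx
      omega
    · rw [symmDiff_adj_iff, fourCycle_adj]
      simp only [Sym2.eq_iff]
      grind
    · rw [symmDiff_adj_iff, fourCycle_adj]
      simp only [Sym2.eq_iff]
      grind
  have hinj : Set.InjOn φ A := by
    rintro ⟨G, x⟩ _ ⟨G', x'⟩ _ e
    simp only [φ, Prod.mk.injEq] at e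
    obtain ⟨e1, rfl⟩ := e
    simpa using e1
  have hAB : ∑ q ∈ A, h q.1 ≤ ∑ q ∈ B, h q.1 := by
    calc ∑ q ∈ A, h q.1 = ∑ q ∈ A, h (φ q).1 := Finset.sum_congr rfl fun q hq => (hφ q hq).2.symm
      _ = ∑ q ∈ A.image φ, h q.1 := (Finset.sum_image (f := fun q => h q.1) hinj).symm
      _ ≤ ∑ q ∈ B, h q.1 := Finset.sum_le_sum_of_subset_of_nonneg
          (Finset.image_subset_iff.2 fun q hq => (hφ q hq).1) fun q _ _ => h0 _
  have hA : (j + 1) * M * ∑ G ∈ (degGraphs d).filter (fun G => nbrCount G X v = j + 1), h G ≤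
      ∑ q ∈ A, h q.1 := by
    have e : ∑ q ∈ A, h q.1 = ∑ G ∈ (degGraphs d).filter (fun G => nbrCount G X v = j + 1),
        ∑ x ∈ X.filter (fun x => G.Adj v x), ((switchable G X v x).card : ℝ) * h G := by
      simp only [A, Finset.sum_filter, ← Finset.univ_product_univ, Finset.sum_product]
      rw [degGraphs, Finset.sum_filter]
      refine Finset.sum_congr rfl fun G _ => ?_
      split_ifs with h1 h2
      · rw [← Finset.sum_filter_add_sum_filter_not Finset.univ (fun x => x ∈ X)]
        rw [Finset.filter_mem_eq_inter, Finset.univ_inter, add_eq_left.2]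
        · refine Finset.sum_congr rfl fun x hx => ?_
          split_ifs with h3
          · rw [← nsmul_eq_mul, ← Finset.sum_const, ← Finset.sum_product',
              Finset.univ_product_univ, ← Finset.sum_filter]
            refine Finset.sum_congr ?_ fun _ _ => rfl
            ext q
            simp [h1, h2, h3, hx, switchable]
          · simp [h3]
        · refine Finset.sum_eq_zero fun x hx => ?_
          have : x ∉ X := by simpa using hx
          simp [this]
      · simp [h2]
      · simp [h1]
    rw [e, Finset.mul_sum]
    refine Finset.sum_le_sum fun G hG => ?_
    rw [Finset.mem_filter] at hG
    have hc : ((X.filter fun x => G.Adj v x).card : ℝ) = j + 1 := by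
      have := hG.2
      unfold nbrCount at this
      exact_mod_cast this
    rw [← hc, mul_assoc, ← nsmul_eq_mul, ← Finset.sum_const]
    refine Finset.sum_le_sum fun x hx => ?_
    rw [Finset.mem_filter] at hx
    exact mul_le_mul_of_nonneg_right (hM G hG.1 x hx.1 hx.2) (h0 G)
  have hB : ∑ q ∈ B, h q.1 =
      d v * ∑ G ∈ (degGraphs d).filter (fun G => nbrCount G X v = j), bdry G X * h G := by
    simp only [B, Finset.sum_filter, ← Finset.univ_product_univ, Finset.sum_product]
    rw [Finset.mul_sum, degGraphs, Finset.sum_filter]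
    refine Finset.sum_congr rfl fun G _ => ?_
    split_ifs with h1 h2
    · have e1 : (d v : ℝ) = ∑ z : V, if G.Adj v z then (1 : ℝ) else 0 := by
        rw [← h1 v, degree_eq_nbrCount]
        simp [nbrCount]
      have e2 : (bdry G X : ℝ) = ∑ x ∈ X, ∑ y ∈ Xᶜ, if G.Adj x y then (1 : ℝ) else 0 := by
        rw [bdry_eq]
        simp [nbrCount]
      rw [e1, e2, ← mul_assoc, mul_comm (∑ z, _), mul_assoc]
      rw [Finset.sum_mul, ← Finset.sum_filter_add_sum_filter_not Finset.univ (fun x => x ∈ X)]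
      rw [Finset.filter_mem_eq_inter, Finset.univ_inter, add_eq_left.2]
      · refine Finset.sum_congr rfl fun x hx => ?_
        rw [Finset.sum_mul, ← Finset.sum_filter_add_sum_filter_not Finset.univ (fun x => x ∈ Xᶜ)]
        rw [Finset.filter_mem_eq_inter, Finset.univ_inter, add_eq_left.2]
        · refine Finset.sum_congr rfl fun y hy => ?_
          have hy' : y ∉ X := by simpa using hy
          rw [Finset.sum_mul, Finset.mul_sum]
          refine Finset.sum_congr rfl fun z _ => ?_
          by_cases h3 : G.Adj x y <;> by_cases h4 : G.Adj v z <;>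
            simp [h2, hx, hy', h3, h4, h1]
        · refine Finset.sum_eq_zero fun y hy => ?_
          have : y ∈ X := by simpa using hy
          simp [this]
      · refine Finset.sum_eq_zero fun x hx => ?_
        have : x ∉ X := by simpa using hx
        simp [this]
    · simp [h2]
    · simp [h1]
  linarith

end Switching

section OneStep

set_option linter.unusedSectionVars false

variable {V : Type*} [Fintype V]

/-- A lower bound for the number of edges available for switching. -/
lemma card_switchable_ge {d : V → ℕ} {G : SimpleGraph V} (hG : G ∈ degGraphs d) {D : ℕ}
    (hD : ∀ i, d i ≤ D) (X : Finset V) (v x : V) :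
    (∑ i, (d i : ℝ)) - 2 * (∑ i ∈ X, (d i : ℝ)) - 2 * D - 2 * (D : ℝ) ^ 2 ≤
      (switchable G X v x).card := by
  rw [mem_degGraphs] at hG
  let T : V → Finset (V × V) := fun a => Finset.univ.filter fun q => G.Adj q.1 q.2 ∧ q.1 = a
  let T' : V → Finset (V × V) := fun a => Finset.univ.filter fun q => G.Adj q.1 q.2 ∧ q.2 = a
  have hT : ∀ a, (T a).card = d a := by
    intro a
    rw [← hG a, degree_eq_nbrCount, nbrCount]
    refine Finset.card_bij' (fun q _ => q.2) (fun b _ => (a, b)) ?_ ?_ ?_ ?_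
    · rintro ⟨b, c⟩ hq
      simp only [T, Finset.mem_filter, Finset.mem_univ, true_and] at hq ⊢
      obtain ⟨h, rfl⟩ := hq; exact h
    · intro b hb; simpa [T] using hb
    · rintro ⟨b, c⟩ hq
      simp only [T, Finset.mem_filter, Finset.mem_univ, true_and] at hq ⊢
      obtain ⟨h, rfl⟩ := hq; rfl
    · intro b hb; rfl
  have hT' : ∀ a, (T' a).card = d a := by
    intro a
    rw [← hG a, degree_eq_nbrCount, nbrCount]
    refine Finset.card_bij' (fun q _ => q.1) (fun b _ => (b, a)) ?_ ?_ ?_ ?_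
    · rintro ⟨b, c⟩ hq
      simp only [T', Finset.mem_filter, Finset.mem_univ, true_and] at hq ⊢
      obtain ⟨h, rfl⟩ := hq; exact h.symm
    · intro b hb; simpa [T', G.adj_comm] using hb
    · rintro ⟨b, c⟩ hq
      simp only [T', Finset.mem_filter, Finset.mem_univ, true_and] at hq ⊢
      obtain ⟨h, rfl⟩ := hq; rfl
    · intro b hb; rfl
  let N : V → Finset V := fun u => Finset.univ.filter fun y => G.Adj u y
  have hN : ∀ u, (N u).card = d u := fun u => by rw [← hG u, degree_eq_nbrCount]; rfl
  have hbig : (Finset.univ : Finset V).biUnion T ⊆ switchable G X v x ∪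
      ((insert v X).biUnion T ∪ (insert v X).biUnion T' ∪ (N x).biUnion T ∪ (N v).biUnion T') := by
    rintro ⟨y, z⟩ hq
    simp only [T, T', N, switchable, Finset.mem_biUnion, Finset.mem_filter, Finset.mem_univ,
      true_and, Finset.mem_union, Finset.mem_insert] at hq ⊢
    obtain ⟨a, h1, rfl⟩ := hq
    grind
  have hcard : ((Finset.univ : Finset V).biUnion T).card = ∑ i, d i := by
    rw [Finset.card_biUnion]
    · exact Finset.sum_congr rfl fun i _ => hT i
    · intro a _ b _ hab
      rw [Function.onFun, Finset.disjoint_left]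
      rintro q h1 h2
      simp only [T, Finset.mem_filter] at h1 h2
      exact hab (h1.2.2.symm.trans h2.2.2)
  have hins : ∑ i ∈ insert v X, d i ≤ ∑ i ∈ X, d i + D := by
    by_cases hv : v ∈ X
    · rw [Finset.insert_eq_of_mem hv]; exact Nat.le_add_right _ _
    · rw [Finset.sum_insert hv, add_comm]; exact Nat.add_le_add_left (hD v) _
  have b1 : ((insert v X).biUnion T).card ≤ ∑ i ∈ X, d i + D :=
    (Finset.card_biUnion_le.trans_eq (Finset.sum_congr rfl fun i _ => hT i)).trans hins
  have b2 : ((insert v X).biUnion T').card ≤ ∑ i ∈ X, d i + D :=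
    (Finset.card_biUnion_le.trans_eq (Finset.sum_congr rfl fun i _ => hT' i)).trans hins
  have b3 : ((N x).biUnion T).card ≤ D * D := by
    refine (Finset.card_biUnion_le_card_mul _ _ D fun i _ => (hT i).trans_le (hD i)).trans ?_
    exact Nat.mul_le_mul_right _ ((hN x).trans_le (hD x))
  have b4 : ((N v).biUnion T').card ≤ D * D := by
    refine (Finset.card_biUnion_le_card_mul _ _ D fun i _ => (hT' i).trans_le (hD i)).trans ?_
    exact Nat.mul_le_mul_right _ ((hN v).trans_le (hD v))
  have key : ∑ i, d i ≤ (switchable G X v x).card +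
      ((∑ i ∈ X, d i + D) + (∑ i ∈ X, d i + D) + D * D + D * D) := by
    rw [← hcard]
    refine (Finset.card_le_card hbig).trans ((Finset.card_union_le _ _).trans ?_)
    refine Nat.add_le_add_left ((Finset.card_union_le _ _).trans (Nat.add_le_add ?_ b4)) _
    refine (Finset.card_union_le _ _).trans (Nat.add_le_add ?_ b3)
    exact (Finset.card_union_le _ _).trans (Nat.add_le_add b1 b2)
  have key' : ((∑ i, d i : ℕ) : ℝ) ≤ ((switchable G X v x).card +
      ((∑ i ∈ X, d i + D) + (∑ i ∈ X, d i + D) + D * D + D * D) : ℕ) := by exact_mod_cast key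
  push_cast at key'
  nlinarith

variable {d : V → ℕ} {X : Finset V} {v : V} {h : SimpleGraph V → ℝ} {M σ u : ℝ}

lemma fiber_le (hv : v ∉ X) (h0 : ∀ G, 0 ≤ h G) (hloc : LocalOn d X h) (hMpos : 0 < M)
    (hM : ∀ G ∈ degGraphs d, ∀ x ∈ X, G.Adj v x → M ≤ (switchable G X v x).card)
    (hσ : ∀ G ∈ degGraphs d, h G ≠ 0 → (bdry G X : ℝ) ≤ σ) (hσ0 : 0 ≤ σ) (j : ℕ) :
    ∑ G ∈ (degGraphs d).filter (fun G => nbrCount G X v = j), h G ≤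
      (σ * d v / M) ^ j / (j.factorial : ℝ) * ∑ G ∈ degGraphs d, h G := by
  induction j with
  | zero =>
    simp only [pow_zero, Nat.factorial_zero, Nat.cast_one, div_one, one_mul]
    exact Finset.sum_le_sum_of_subset_of_nonneg (Finset.filter_subset _ _) fun _ _ _ => h0 _
  | succ j ih =>
    have hs := switching d hv h0 hloc hM j
    have h1 : ∑ G ∈ (degGraphs d).filter (fun G => nbrCount G X v = j), bdry G X * h G ≤
        σ * ∑ G ∈ (degGraphs d).filter (fun G => nbrCount G X v = j), h G := by
      rw [Finset.mul_sum]
      refine Finset.sum_le_sum fun G hG => ?_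
      rcases eq_or_ne (h G) 0 with e | e
      · simp [e]
      · exact mul_le_mul_of_nonneg_right (hσ G (Finset.mem_filter.1 hG).1 e) (h0 G)
    have hj : (0 : ℝ) < (j + 1) * M := by positivity
    have h2 := hs.trans (mul_le_mul_of_nonneg_left (h1.trans
      (mul_le_mul_of_nonneg_left ih hσ0)) (Nat.cast_nonneg (d v)))
    rw [← le_div_iff₀' hj] at h2
    refine h2.trans_eq ?_
    rw [Nat.factorial_succ, pow_succ]
    push_cast
    generalize (σ * d v / M) ^ j = r
    field_simp

lemma sum_pow_nbrCount_le (hv : v ∉ X) (h0 : ∀ G, 0 ≤ h G) (hloc : LocalOn d X h) (hMpos : 0 < M)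
    (hM : ∀ G ∈ degGraphs d, ∀ x ∈ X, G.Adj v x → M ≤ (switchable G X v x).card)
    (hσ : ∀ G ∈ degGraphs d, h G ≠ 0 → (bdry G X : ℝ) ≤ σ) (hσ0 : 0 ≤ σ) (hu : 0 ≤ u) :
    ∑ G ∈ degGraphs d, h G * u ^ nbrCount G X v ≤
      Real.exp (u * (σ * d v / M)) * ∑ G ∈ degGraphs d, h G := by
  have hmap : ∀ G ∈ degGraphs d, nbrCount G X v ∈ Finset.range (X.card + 1) := fun G _ =>
    Finset.mem_range.2 (Nat.lt_succ_of_le (nbrCount_le_card G X v))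
  have hH : 0 ≤ ∑ G ∈ degGraphs d, h G := Finset.sum_nonneg fun G _ => h0 G
  rw [← Finset.sum_fiberwise_of_maps_to hmap]
  have hr : 0 ≤ σ * d v / M := by positivity
  calc _ ≤ ∑ j ∈ Finset.range (X.card + 1), (u * (σ * d v / M)) ^ j / (j.factorial : ℝ) *
        ∑ G ∈ degGraphs d, h G := by
        refine Finset.sum_le_sum fun j _ => ?_
        have := mul_le_mul_of_nonneg_left (fiber_le hv h0 hloc hMpos hM hσ hσ0 j) (pow_nonneg hu j)
        rw [Finset.mul_sum] at this
        refine (le_of_eq ?_).trans (this.trans_eq ?_)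
        · refine Finset.sum_congr rfl fun G hG => ?_
          rw [(Finset.mem_filter.1 hG).2, mul_comm]
        · rw [mul_pow]; ring
    _ ≤ _ := by
        rw [← Finset.sum_mul]
        exact mul_le_mul_of_nonneg_right (Real.sum_le_exp_of_nonneg (mul_nonneg hu hr) _) hH

lemma sum_nbrCount_pow_le (hv : v ∉ X) (h0 : ∀ G, 0 ≤ h G) (hloc : LocalOn d X h) (hMpos : 0 < M)
    (hM : ∀ G ∈ degGraphs d, ∀ x ∈ X, G.Adj v x → M ≤ (switchable G X v x).card)
    (hσ : ∀ G ∈ degGraphs d, h G ≠ 0 → (bdry G X : ℝ) ≤ σ) (hσ0 : 0 ≤ σ) (hu : 0 ≤ u) :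
    ∑ G ∈ degGraphs d, h G * (nbrCount G X v / bdry G X * u ^ nbrCount G X v) ≤
      d v / M * u * Real.exp (u * (σ * d v / M)) * ∑ G ∈ degGraphs d, h G := by
  have hmap : ∀ G ∈ degGraphs d, nbrCount G X v ∈ Finset.range (X.card + 1) := fun G _ =>
    Finset.mem_range.2 (Nat.lt_succ_of_le (nbrCount_le_card G X v))
  have hmain := sum_pow_nbrCount_le hv h0 hloc hMpos hM hσ hσ0 hu
  have hloc' : LocalOn d X fun G => h G / bdry G X := hloc.comp₂ (localOn_bdry d X) fun a b => a / b
  have h0' : ∀ G, 0 ≤ h G / bdry G X := fun G => div_nonneg (h0 G) (Nat.cast_nonneg _)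
  have hdM : 0 ≤ d v / M * u := by positivity
  have hstep : ∀ j : ℕ,
      ∑ G ∈ (degGraphs d).filter (fun G => nbrCount G X v = j + 1),
        h G * (nbrCount G X v / bdry G X * u ^ nbrCount G X v) ≤
      d v / M * u * ∑ G ∈ (degGraphs d).filter (fun G => nbrCount G X v = j),
        h G * u ^ nbrCount G X v := by
    intro j
    have hs := switching d hv h0' hloc' hM j
    have h1 : ∑ G ∈ (degGraphs d).filter (fun G => nbrCount G X v = j),
        bdry G X * (h G / bdry G X) ≤
        ∑ G ∈ (degGraphs d).filter (fun G => nbrCount G X v = j), h G := by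
      refine Finset.sum_le_sum fun G _ => ?_
      rcases eq_or_ne (bdry G X : ℝ) 0 with e | e
      · simp [e, h0]
      · rw [mul_div_cancel₀ _ e]
    have h2 := hs.trans (mul_le_mul_of_nonneg_left h1 (Nat.cast_nonneg (d v)))
    have e1 : ∑ G ∈ (degGraphs d).filter (fun G => nbrCount G X v = j + 1),
        h G * (nbrCount G X v / bdry G X * u ^ nbrCount G X v) = u ^ (j + 1) / M *
        ((j + 1) * M * ∑ G ∈ (degGraphs d).filter (fun G => nbrCount G X v = j + 1),
          h G / bdry G X) := by
      rw [Finset.mul_sum, Finset.mul_sum]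
      refine Finset.sum_congr rfl fun G hG => ?_
      rw [(Finset.mem_filter.1 hG).2]
      push_cast
      field_simp
    have e2 : ∑ G ∈ (degGraphs d).filter (fun G => nbrCount G X v = j),
        h G * u ^ nbrCount G X v =
        u ^ j * ∑ G ∈ (degGraphs d).filter (fun G => nbrCount G X v = j), h G := by
      rw [Finset.mul_sum]
      refine Finset.sum_congr rfl fun G hG => ?_
      rw [(Finset.mem_filter.1 hG).2, mul_comm]
    rw [e1, e2]
    refine (mul_le_mul_of_nonneg_left h2 (by positivity)).trans_eq ?_
    rw [pow_succ]; ring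
  rw [mul_assoc (_ * u)]
  refine le_trans ?_ (mul_le_mul_of_nonneg_left hmain hdM)
  rw [← Finset.sum_fiberwise_of_maps_to hmap, ← Finset.sum_fiberwise_of_maps_to hmap,
    Finset.sum_range_succ', Finset.mul_sum, Finset.sum_range_succ]
  have z : ∑ G ∈ (degGraphs d).filter (fun G => nbrCount G X v = 0),
        h G * (nbrCount G X v / bdry G X * u ^ nbrCount G X v) = 0 :=
    Finset.sum_eq_zero fun G hG => by rw [(Finset.mem_filter.1 hG).2]; simp
  rw [z, add_zero]
  refine le_add_of_le_of_nonneg (Finset.sum_le_sum fun j _ => hstep j) ?_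
  exact mul_nonneg hdM (Finset.sum_nonneg fun G _ => mul_nonneg (h0 G) (pow_nonneg hu _))

/-- The one-step contraction factor of `exp (-θ * bdry)`. -/
def stepFactor (d : V → ℕ) (M σ θ : ℝ) : ℝ :=
  ∑ v, d v / M * Real.exp (2 * θ - (θ - Real.exp (2 * θ) * σ / M) * d v)

/-- Average of a function over one exploration step. -/
def stepAvg (G : SimpleGraph V) (X : Finset V) (φ : Finset V → ℝ) : ℝ :=
  ∑ v ∈ Xᶜ, nbrCount G X v / bdry G X * φ (insert v X)

lemma one_step (h0 : ∀ G, 0 ≤ h G) (hloc : LocalOn d X h) (hMpos : 0 < M)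
    (hM : ∀ v, ∀ G ∈ degGraphs d, ∀ x ∈ X, G.Adj v x → M ≤ (switchable G X v x).card)
    (hσ : ∀ G ∈ degGraphs d, h G ≠ 0 → (bdry G X : ℝ) ≤ σ) (hσ0 : 0 ≤ σ) (θ : ℝ) :
    ∑ G ∈ degGraphs d, h G * stepAvg G X (fun Y => Real.exp (-θ * bdry G Y)) ≤
      stepFactor d M σ θ * ∑ G ∈ degGraphs d, h G * Real.exp (-θ * bdry G X) := by
  simp only [stepAvg, Finset.mul_sum]
  rw [Finset.sum_comm]
  simp only [← Finset.mul_sum]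
  have hloc' : LocalOn d X fun G => h G * Real.exp (-θ * bdry G X) :=
    hloc.comp₂ (localOn_bdry d X) fun a b => a * Real.exp (-θ * b)
  have hH : 0 ≤ ∑ G ∈ degGraphs d, h G * Real.exp (-θ * bdry G X) :=
    Finset.sum_nonneg fun G _ => mul_nonneg (h0 G) (Real.exp_pos _).le
  rw [stepFactor, Finset.sum_mul]
  refine le_trans (Finset.sum_le_sum fun v hv => ?_)
    (Finset.sum_le_sum_of_subset_of_nonneg (Finset.subset_univ Xᶜ) fun v _ _ => by positivity)
  rw [Finset.mem_compl] at hv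
  have hm := sum_nbrCount_pow_le (u := Real.exp (2 * θ)) hv
    (fun G => mul_nonneg (h0 G) (Real.exp_pos _).le) hloc' hMpos (hM v)
    (fun G hG e => hσ G hG (left_ne_zero_of_mul e)) hσ0 (Real.exp_pos _).le
  have hm' := mul_le_mul_of_nonneg_left hm (Real.exp_pos (-θ * d v)).le
  rw [Finset.mul_sum] at hm'
  refine (le_of_eq ?_).trans (hm'.trans_eq ?_)
  · refine Finset.sum_congr rfl fun G hG => ?_
    have hb : (bdry G (insert v X) : ℝ) = bdry G X + d v - 2 * nbrCount G X v := by
      have := bdry_insert G hv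
      rw [mem_degGraphs.1 hG] at this
      have : (bdry G (insert v X) : ℝ) + 2 * nbrCount G X v = bdry G X + d v := by exact_mod_cast this
      linarith
    have he : Real.exp (-θ * bdry G (insert v X)) =
        Real.exp (-θ * d v) * Real.exp (-θ * bdry G X) * Real.exp (2 * θ) ^ nbrCount G X v := by
      rw [← Real.exp_nat_mul, ← Real.exp_add, ← Real.exp_add, hb]
      ring_nf
    rw [he]; ring
  · have he : Real.exp (2 * θ - (θ - Real.exp (2 * θ) * σ / M) * d v) =
        Real.exp (-θ * d v) * Real.exp (2 * θ) * Real.exp (Real.exp (2 * θ) * (σ * d v / M)) := by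
      rw [← Real.exp_add, ← Real.exp_add]
      ring_nf
    rw [he]; ring

end OneStep

section Chain

set_option linter.unusedSectionVars false

variable {V : Type*} [Fintype V]

/-- Probability that the exploration process started from `X` meets `bad` within `f` steps,
before it meets `halt`. -/
def badProb (bad halt : SimpleGraph V → Finset V → Prop) (G : SimpleGraph V) :
    ℕ → Finset V → ℝ
  | 0, _ => 0
  | f + 1, X => if bad G X then 1 else if halt G X then 0 else
      stepAvg G X (badProb bad halt G f)

variable {bad halt : SimpleGraph V → Finset V → Prop}

lemma badProb_nonneg (G : SimpleGraph V) (f : ℕ) (X : Finset V) :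
    0 ≤ badProb bad halt G f X := by
  induction f generalizing X with
  | zero => exact le_rfl
  | succ f ih =>
    rw [badProb]
    split_ifs
    · exact zero_le_one
    · exact le_rfl
    · exact Finset.sum_nonneg fun v _ => mul_nonneg (by positivity) (ih _)

lemma sum_badProb_le {d : V → ℕ} {θ ρ : ℝ} (hρ : 0 ≤ ρ) {A : ℕ → ℝ} (hA : ∀ k, 0 ≤ A k) {K : ℕ}
    (lhalt : ∀ X, LocalOn d X fun G => halt G X)
    (hbad : ∀ G ∈ degGraphs d, ∀ X, bad G X → 1 ≤ A X.card * Real.exp (-θ * bdry G X))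
    (hstep : ∀ X : Finset V, X.card < K → ∀ h : SimpleGraph V → ℝ, (∀ G, 0 ≤ h G) →
      LocalOn d X h → (∀ G ∈ degGraphs d, halt G X → h G = 0) →
      ∑ G ∈ degGraphs d, h G * stepAvg G X (fun Y => Real.exp (-θ * bdry G Y)) ≤
        ρ * ∑ G ∈ degGraphs d, h G * Real.exp (-θ * bdry G X))
    (f : ℕ) : ∀ X : Finset V, X.card + f ≤ K → ∀ h : SimpleGraph V → ℝ, (∀ G, 0 ≤ h G) →
      LocalOn d X h →
      ∑ G ∈ degGraphs d, h G * badProb bad halt G f X ≤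
        (∑ j ∈ Finset.range f, ρ ^ j * A (X.card + j)) *
          ∑ G ∈ degGraphs d, h G * Real.exp (-θ * bdry G X) := by
  induction f with
  | zero => intro X _ h _ _; simp [badProb]
  | succ f ih =>
    intro X hX h h0 hloc
    set h' : SimpleGraph V → ℝ := fun G => if halt G X then 0 else h G with hh'
    have h0' : ∀ G, 0 ≤ h' G := fun G => by simp only [hh']; split_ifs <;> simp [h0]
    have hle' : ∀ G, h' G ≤ h G := fun G => by simp only [hh']; split_ifs <;> simp [h0]
    have hloc' : LocalOn d X h' := (lhalt X).comp₂ hloc fun a b => if a then 0 else b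
    have hB : 0 ≤ ∑ j ∈ Finset.range f, ρ ^ j * A (X.card + 1 + j) :=
      Finset.sum_nonneg fun j _ => mul_nonneg (pow_nonneg hρ _) (hA _)
    have hsplit : ∀ G ∈ degGraphs d, h G * badProb bad halt G (f + 1) X ≤
        A X.card * (h G * Real.exp (-θ * bdry G X)) +
          h' G * stepAvg G X (badProb bad halt G f) := by
      intro G hG
      have p1 : 0 ≤ A X.card * (h G * Real.exp (-θ * bdry G X)) :=
        mul_nonneg (hA _) (mul_nonneg (h0 G) (Real.exp_pos _).le)
      have p2 : 0 ≤ h' G * stepAvg G X (badProb bad halt G f) :=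
        mul_nonneg (h0' G) (Finset.sum_nonneg fun v _ =>
          mul_nonneg (by positivity) (badProb_nonneg _ _ _))
      rw [badProb]
      split_ifs with c1 c2
      · have := mul_le_mul_of_nonneg_left (hbad G hG X c1) (h0 G)
        linarith
      · linarith
      · have : h' G = h G := by simp [hh', c2]
        rw [this]; linarith
    have hsecond : ∑ G ∈ degGraphs d, h' G * stepAvg G X (badProb bad halt G f) ≤
        (∑ j ∈ Finset.range f, ρ ^ j * A (X.card + 1 + j)) *
          ∑ G ∈ degGraphs d, h' G * stepAvg G X (fun Y => Real.exp (-θ * bdry G Y)) := by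
      simp only [stepAvg, Finset.mul_sum (s := Xᶜ)]
      rw [Finset.sum_comm, Finset.sum_comm (s := degGraphs d), Finset.mul_sum]
      refine Finset.sum_le_sum fun v hv => ?_
      have hv' := Finset.mem_compl.1 hv
      have hc := Finset.card_insert_of_notMem hv'
      have l1 : LocalOn d (insert v X) fun G => h' G * ((nbrCount G X v : ℝ) / bdry G X) :=
        (hloc'.mono (Finset.subset_insert v X)).comp₂
          ((localOn_nbrCount d (Finset.mem_insert_self v X) (Finset.subset_insert v X)).comp₂
            ((localOn_bdry d X).mono (Finset.subset_insert v X)) fun a b => (a : ℝ) / b)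
          fun a b => a * b
      have := ih (insert v X) (by omega) (fun G => h' G * ((nbrCount G X v : ℝ) / bdry G X))
        (fun G => mul_nonneg (h0' G) (by positivity)) l1
      rw [hc] at this
      simpa only [mul_assoc] using this
    have hst := hstep X (by omega) h' h0' hloc' fun G _ hs => by simp [hh', hs]
    have hlast : ∑ G ∈ degGraphs d, h' G * Real.exp (-θ * bdry G X) ≤
        ∑ G ∈ degGraphs d, h G * Real.exp (-θ * bdry G X) :=
      Finset.sum_le_sum fun G _ => mul_le_mul_of_nonneg_right (hle' G) (Real.exp_pos _).le
    calc ∑ G ∈ degGraphs d, h G * badProb bad halt G (f + 1) X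
        ≤ A X.card * ∑ G ∈ degGraphs d, h G * Real.exp (-θ * bdry G X) +
          ∑ G ∈ degGraphs d, h' G * stepAvg G X (badProb bad halt G f) := by
          rw [Finset.mul_sum, ← Finset.sum_add_distrib]
          exact Finset.sum_le_sum hsplit
      _ ≤ A X.card * ∑ G ∈ degGraphs d, h G * Real.exp (-θ * bdry G X) +
          (∑ j ∈ Finset.range f, ρ ^ j * A (X.card + 1 + j)) *
            (ρ * ∑ G ∈ degGraphs d, h G * Real.exp (-θ * bdry G X)) := by
          refine add_le_add le_rfl (hsecond.trans (mul_le_mul_of_nonneg_left ?_ hB))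
          exact hst.trans (mul_le_mul_of_nonneg_left hlast hρ)
      _ = _ := by
          rw [Finset.sum_range_succ', pow_zero, one_mul, add_zero, add_mul, add_comm]
          congr 1
          rw [Finset.sum_mul, Finset.sum_mul]
          refine Finset.sum_congr rfl fun j _ => ?_
          rw [show X.card + (j + 1) = X.card + 1 + j by ring, pow_succ]
          ring

/-- A set without outgoing edges that is minimal as such is found by the exploration. -/
lemma badProb_eq_one_of_closed {G : SimpleGraph V} {K : Finset V}
    (hmin : ∀ X ⊆ K, X.Nonempty → X ≠ K → bdry G X ≠ 0)
    (hclosed : ∀ x ∈ K, ∀ v ∉ K, ¬ G.Adj v x) (hK : bad G K)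
    (hhalt : ∀ X ⊆ K, halt G X → bad G X) (f : ℕ) :
    ∀ X ⊆ K, X.Nonempty → K.card < X.card + f → badProb bad halt G f X = 1 := by
  induction f with
  | zero =>
    intro X hX _ h
    have := Finset.card_le_card hX
    omega
  | succ f ih =>
    intro X hX hne h
    rw [badProb]
    by_cases c : bad G X
    · rw [if_pos c]
    rw [if_neg c, if_neg fun hs => c (hhalt X hX hs)]
    have hXK : X ≠ K := fun e => c (e ▸ hK)
    have hb := hmin X hX hne hXK
    have hb' : (bdry G X : ℝ) ≠ 0 := by exact_mod_cast hb
    calc stepAvg G X (badProb bad halt G f)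
        = ∑ v ∈ Xᶜ, (nbrCount G X v : ℝ) / bdry G X := by
          refine Finset.sum_congr rfl fun v hv => ?_
          have hv' := Finset.mem_compl.1 hv
          by_cases hvK : v ∈ K
          · rw [ih (insert v X) (Finset.insert_subset hvK hX) (Finset.insert_nonempty _ _)
              (by rw [Finset.card_insert_of_notMem hv']; omega), mul_one]
          · have : nbrCount G X v = 0 := by
              rw [nbrCount, Finset.card_eq_zero, Finset.filter_eq_empty_iff]
              exact fun x hx => hclosed x (hX hx) v hvK
            simp [this]
      _ = 1 := by
          rw [← Finset.sum_div, ← Nat.cast_sum]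
          exact div_self hb'

end Chain

section FirstPassage

set_option linter.unusedSectionVars false

variable {V : Type*} [Fintype V]

/-- Weighted distance from a set. -/
def setDist (G : SimpleGraph V) (w : Sym2 V → ℝ) (X : Finset V) (b : V) : ℝ :=
  sInf {r | ∃ x ∈ X, ∃ p : G.Walk x b, r = (p.edges.map w).sum}

/-- First time at which the ball around `X` has `k` vertices. -/
def setHit (G : SimpleGraph V) (w : Sym2 V → ℝ) (X : Finset V) (k : ℕ) : ℝ :=
  sInf {t | 0 ≤ t ∧ k ≤ (Finset.univ.filter fun b => setDist G w X b ≤ t).card}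

lemma setDist_singleton (G : SimpleGraph V) (w : Sym2 V → ℝ) (a b : V) :
    setDist G w {a} b = distW G w a b := by
  simp [setDist, distW]

lemma hitTime_eq_setHit (G : SimpleGraph V) (w : Sym2 V → ℝ) (a : V) (k : ℝ) :
    hitTime G w a k = setHit G w {a} ⌈k⌉₊ := by
  unfold hitTime setHit
  congr 1
  ext t
  simp only [Set.mem_ofPred_eq, Nat.ceil_le, setDist_singleton]
  rw [← Set.ncard_coe_finset]
  simp [ballW]

lemma setHit_nonneg (G : SimpleGraph V) (w : Sym2 V → ℝ) (X : Finset V) (k : ℕ) :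
    0 ≤ setHit G w X k := Real.sInf_nonneg fun _ h => h.1

lemma setHit_eq_zero_of_card_le {G : SimpleGraph V} {w : Sym2 V → ℝ} {X : Finset V} {k : ℕ}
    (h : k ≤ (Finset.univ.filter fun b => setDist G w X b ≤ 0).card) : setHit G w X k = 0 :=
  le_antisymm (csInf_le ⟨0, fun _ h => h.1⟩ ⟨le_rfl, h⟩) (setHit_nonneg G w X k)

lemma walk_weight_nonneg {G : SimpleGraph V} {w : Sym2 V → ℝ} (hw : ∀ e, 0 ≤ w e) {a b : V}
    (p : G.Walk a b) : 0 ≤ (p.edges.map w).sum :=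
  List.sum_nonneg fun x hx => by
    obtain ⟨e, _, rfl⟩ := List.mem_map.1 hx
    exact hw e

lemma setDist_nonneg {G : SimpleGraph V} {w : Sym2 V → ℝ} (hw : ∀ e, 0 ≤ w e) (X : Finset V)
    (b : V) : 0 ≤ setDist G w X b :=
  Real.sInf_nonneg fun r hr => by
    obtain ⟨x, _, p, rfl⟩ := hr
    exact walk_weight_nonneg hw p

lemma setDist_le {G : SimpleGraph V} {w : Sym2 V → ℝ} (hw : ∀ e, 0 ≤ w e) {X : Finset V}
    {x b : V} (hx : x ∈ X) (p : G.Walk x b) : setDist G w X b ≤ (p.edges.map w).sum :=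
  csInf_le ⟨0, fun r hr => by
    obtain ⟨x, _, p, rfl⟩ := hr
    exact walk_weight_nonneg hw p⟩ ⟨x, hx, p, rfl⟩

lemma le_setDist {G : SimpleGraph V} (hG : G.Preconnected) {w : Sym2 V → ℝ} {X : Finset V}
    (hX : X.Nonempty) {b : V} {r : ℝ}
    (h : ∀ x ∈ X, ∀ p : G.Walk x b, r ≤ (p.edges.map w).sum) : r ≤ setDist G w X b := by
  obtain ⟨x, hx⟩ := hX
  obtain ⟨p⟩ := hG x b
  refine le_csInf ⟨_, x, hx, p, rfl⟩ ?_
  rintro r ⟨y, hy, q, rfl⟩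
  exact h y hy q

lemma setDist_of_mem {G : SimpleGraph V} {w : Sym2 V → ℝ} (hw : ∀ e, 0 ≤ w e) {X : Finset V}
    {b : V} (hb : b ∈ X) : setDist G w X b = 0 :=
  le_antisymm (by simpa using setDist_le hw hb (SimpleGraph.Walk.nil : G.Walk b b))
    (setDist_nonneg hw X b)

/-- The edges leaving `X`. -/
def bdryEdges (G : SimpleGraph V) (X : Finset V) : Finset (Sym2 V) :=
  Finset.univ.filter fun e => ∃ x ∈ X, ∃ y ∉ X, G.Adj x y ∧ e = s(x, y)

lemma mem_bdryEdges {G : SimpleGraph V} {X : Finset V} {x y : V} (h : G.Adj x y) :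
    s(x, y) ∈ bdryEdges G X ↔ (x ∈ X ↔ y ∉ X) := by
  simp only [bdryEdges, Finset.mem_filter, Finset.mem_univ, true_and, Sym2.eq_iff]
  constructor
  · grind
  · intro h'
    by_cases hx : x ∈ X
    · exact ⟨x, hx, y, h'.1 hx, h, Or.inl ⟨rfl, rfl⟩⟩
    · exact ⟨y, by tauto, x, hx, h.symm, Or.inr ⟨rfl, rfl⟩⟩

lemma card_bdryEdges (G : SimpleGraph V) (X : Finset V) : (bdryEdges G X).card = bdry G X := by
  have h1 : bdry G X = ((Xᶜ).sigma fun v => X.filter fun x => G.Adj v x).card := by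
    rw [Finset.card_sigma]; rfl
  rw [h1]
  symm
  refine Finset.card_bij (fun q _ => s(q.1, q.2)) ?_ ?_ ?_
  · rintro ⟨v, x⟩ hq
    simp only [Finset.mem_sigma, Finset.mem_compl, Finset.mem_filter] at hq
    rw [mem_bdryEdges hq.2.2]
    tauto
  · rintro ⟨v, x⟩ hq ⟨v', x'⟩ hq' e
    simp only [Finset.mem_sigma, Finset.mem_compl, Finset.mem_filter] at hq hq'
    simp only [Sym2.eq_iff] at e
    grind
  · intro e he
    simp only [bdryEdges, Finset.mem_filter, Finset.mem_univ, true_and] at he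
    obtain ⟨x, hx, y, hy, hxy, rfl⟩ := he
    exact ⟨⟨y, x⟩, by simp [hx, hy, hxy.symm], Sym2.eq_swap⟩

/-- Weights remaining after the edges leaving `X` have been followed for time `m`. -/
def residual (G : SimpleGraph V) (X : Finset V) (m : ℝ) (w : Sym2 V → ℝ) : Sym2 V → ℝ :=
  fun f => if f ∈ bdryEdges G X then w f - m else w f

lemma residual_nonneg {G : SimpleGraph V} {X : Finset V} {m : ℝ} {w : Sym2 V → ℝ}
    (hw : ∀ e, 0 ≤ w e) (hmin : ∀ f ∈ bdryEdges G X, m ≤ w f) (e : Sym2 V) :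
    0 ≤ residual G X m w e := by
  unfold residual
  split_ifs with h
  · linarith [hmin e h]
  · exact hw e

lemma setDist_residual {G : SimpleGraph V} (hG : G.Preconnected) {X : Finset V} {w : Sym2 V → ℝ}
    (hw : ∀ e, 0 ≤ w e) {x v : V} (hx : x ∈ X) (hv : v ∉ X) (hxv : G.Adj x v)
    (hmin : ∀ f ∈ bdryEdges G X, w s(x, v) ≤ w f) {b : V} (hb : b ∉ X) :
    setDist G w X b =
      w s(x, v) + setDist G (residual G X (w s(x, v)) w) (insert v X) b := by
  set m := w s(x, v)
  set w' := residual G X m w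
  have hm : 0 ≤ m := hw _
  have hw' : ∀ e, 0 ≤ w' e := residual_nonneg hw hmin
  have hedge : ∀ y z, G.Adj y z → z ∉ X →
      (y ∈ X → w s(y, z) = m + w' s(y, z)) ∧ (y ∉ X → w' s(y, z) = w s(y, z)) := by
    intro y z hyz hz
    constructor
    · intro hy
      have : s(y, z) ∈ bdryEdges G X := (mem_bdryEdges hyz).2 (by tauto)
      simp [w', residual, this]
    · intro hy
      have : s(y, z) ∉ bdryEdges G X := fun h => by
        have := (mem_bdryEdges hyz).1 h
        tauto
      simp [w', residual, this]
  apply le_antisymm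
  · suffices h : m + setDist G w' (insert v X) b ≥ setDist G w X b from h
    have key : ∀ {y c : V} (p : G.Walk y c),
        (∃ x' ∈ X, ∃ q : G.Walk x' c, (q.edges.map w).sum ≤ m + (p.edges.map w').sum) ∨
        (y ∉ X ∧ (p.edges.map w).sum = (p.edges.map w').sum) := by
      intro y c p
      induction p with
      | nil =>
        rename_i u
        by_cases hu : u ∈ X
        · exact Or.inl ⟨u, hu, SimpleGraph.Walk.nil, by simpa using hm⟩
        · exact Or.inr ⟨hu, by simp⟩
      | cons hyz p ih =>
        rename_i y z c
        rcases ih with ⟨x', hx', q, hq⟩ | ⟨hz, e⟩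
        · refine Or.inl ⟨x', hx', q, hq.trans ?_⟩
          have := hw' s(y, z)
          simp only [SimpleGraph.Walk.edges_cons, List.map_cons, List.sum_cons]
          linarith
        · by_cases hy : y ∈ X
          · refine Or.inl ⟨y, hy, SimpleGraph.Walk.cons hyz p, ?_⟩
            simp only [SimpleGraph.Walk.edges_cons, List.map_cons, List.sum_cons]
            rw [(hedge y z hyz hz).1 hy, e]; linarith
          · refine Or.inr ⟨hy, ?_⟩
            simp only [SimpleGraph.Walk.edges_cons, List.map_cons, List.sum_cons]
            rw [(hedge y z hyz hz).2 hy, e]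
    have : setDist G w X b - m ≤ setDist G w' (insert v X) b := by
      refine le_setDist hG (Finset.insert_nonempty v X) fun y hy p => ?_
      rcases key p with ⟨x', hx', q, hq⟩ | ⟨hyX, e⟩
      · linarith [setDist_le hw hx' q]
      · have hyv : y = v := by
          rcases Finset.mem_insert.1 hy with h | h
          · exact h
          · exact absurd h hyX
        subst hyv
        have := setDist_le hw hx (SimpleGraph.Walk.cons hxv p)
        simp only [SimpleGraph.Walk.edges_cons, List.map_cons, List.sum_cons] at this
        change _ ≤ m + _ at this
        linarith
    linarith
  · have key : ∀ {y c : V} (p : G.Walk y c), c ∉ X →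
        (∃ x' ∈ insert v X, ∃ q : G.Walk x' c, m + (q.edges.map w').sum ≤ (p.edges.map w).sum) ∨
        (y ∉ X ∧ (p.edges.map w).sum = (p.edges.map w').sum) := by
      intro y c p
      induction p with
      | nil => exact fun hc => Or.inr ⟨hc, by simp⟩
      | cons hyz p ih =>
        rename_i y z c
        intro hc
        rcases ih hc with ⟨x', hx', q, hq⟩ | ⟨hz, e⟩
        · refine Or.inl ⟨x', hx', q, hq.trans ?_⟩
          have := hw s(y, z)
          simp only [SimpleGraph.Walk.edges_cons, List.map_cons, List.sum_cons]
          linarith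
        · by_cases hy : y ∈ X
          · refine Or.inl ⟨y, Finset.mem_insert_of_mem hy, SimpleGraph.Walk.cons hyz p, ?_⟩
            simp only [SimpleGraph.Walk.edges_cons, List.map_cons, List.sum_cons]
            rw [(hedge y z hyz hz).1 hy, e]; linarith
          · refine Or.inr ⟨hy, ?_⟩
            simp only [SimpleGraph.Walk.edges_cons, List.map_cons, List.sum_cons]
            rw [(hedge y z hyz hz).2 hy, e]
    refine le_setDist hG ⟨x, hx⟩ fun y hy p => ?_
    rcases key p hb with ⟨x', hx', q, hq⟩ | ⟨hyX, _⟩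
    · linarith [setDist_le hw' hx' q]
    · exact absurd hy hyX

lemma setHit_eq_zero {G : SimpleGraph V} {w : Sym2 V → ℝ} (hw : ∀ e, 0 ≤ w e) {X : Finset V}
    {k : ℕ} (hk : k ≤ X.card) : setHit G w X k = 0 :=
  setHit_eq_zero_of_card_le (hk.trans (Finset.card_le_card fun b hb => by
    simp [setDist_of_mem hw hb]))

lemma setHit_set_nonempty (G : SimpleGraph V) (w : Sym2 V → ℝ) (X : Finset V) {k : ℕ}
    (hk : k ≤ Fintype.card V) :
    {t | 0 ≤ t ∧ k ≤ (Finset.univ.filter fun b => setDist G w X b ≤ t).card}.Nonempty := by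
  refine ⟨∑ b, |setDist G w X b|, Finset.sum_nonneg fun b _ => abs_nonneg _, ?_⟩
  rw [Finset.filter_true_of_mem, Finset.card_univ]
  · exact hk
  · exact fun b hb => (le_abs_self _).trans
      (Finset.single_le_sum (f := fun b => |setDist G w X b|) (fun _ _ => abs_nonneg _) hb)

lemma setHit_residual {G : SimpleGraph V} (hG : G.Preconnected) {X : Finset V} {w : Sym2 V → ℝ}
    (hw : ∀ e, 0 ≤ w e) {x v : V} (hx : x ∈ X) (hv : v ∉ X) (hxv : G.Adj x v)
    (hmin : ∀ f ∈ bdryEdges G X, w s(x, v) ≤ w f) {k : ℕ} (hk : X.card < k)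
    (hkV : k ≤ Fintype.card V) :
    setHit G w X k = w s(x, v) + setHit G (residual G X (w s(x, v)) w) (insert v X) k := by
  set m := w s(x, v) with hmdef
  set w' := residual G X m w with hw'def
  have hm : 0 ≤ m := hw _
  have hw' : ∀ e, 0 ≤ w' e := residual_nonneg hw hmin
  have hball : ∀ t, 0 ≤ t → (Finset.univ.filter fun b => setDist G w X b ≤ m + t) =
      Finset.univ.filter fun b => setDist G w' (insert v X) b ≤ t := by
    intro t ht
    ext b
    simp only [Finset.mem_filter, Finset.mem_univ, true_and]
    by_cases hb : b ∈ X
    · rw [setDist_of_mem hw hb, setDist_of_mem hw' (Finset.mem_insert_of_mem hb)]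
      exact ⟨fun _ => ht, fun _ => by linarith⟩
    · rw [setDist_residual hG hw hx hv hxv hmin hb]
      exact add_le_add_iff_left m
  apply le_antisymm
  · rw [← sub_le_iff_le_add']
    refine le_csInf (setHit_set_nonempty G w' _ hkV) ?_
    rintro t ⟨ht, hc⟩
    rw [sub_le_iff_le_add']
    refine csInf_le ⟨0, fun _ h => h.1⟩ ⟨by linarith, ?_⟩
    rwa [hball t ht]
  · refine le_csInf (setHit_set_nonempty G w _ hkV) ?_
    rintro t ⟨ht, hc⟩
    have hmt : m ≤ t := by
      by_contra hlt
      have : (Finset.univ.filter fun b => setDist G w X b ≤ t) ⊆ X := by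
        intro b hb
        by_contra hbX
        simp only [Finset.mem_filter, Finset.mem_univ, true_and] at hb
        rw [setDist_residual hG hw hx hv hxv hmin hbX] at hb
        have := setDist_nonneg (G := G) hw' (insert v X) b
        linarith
      have := Finset.card_le_card this
      omega
    have hsub : t = m + (t - m) := by ring
    rw [hsub, hball _ (by linarith)] at hc
    have : setHit G w' (insert v X) k ≤ t - m :=
      csInf_le ⟨0, fun _ h => h.1⟩ ⟨by linarith, hc⟩
    linarith

/-- The distances from `X` do not depend on the weights of the edges inside `X`. -/
lemma setDist_congr {G : SimpleGraph V} (hG : G.Preconnected) {X : Finset V} (hX : X.Nonempty)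
    {w w' : Sym2 V → ℝ} (hw : ∀ e, 0 ≤ w e) (hw' : ∀ e, 0 ≤ w' e)
    (h : ∀ e, ¬ (∃ x ∈ X, ∃ y ∈ X, e = s(x, y)) → w e = w' e) (b : V) :
    setDist G w X b = setDist G w' X b := by
  have main : ∀ w w' : Sym2 V → ℝ, (∀ e, 0 ≤ w e) → (∀ e, 0 ≤ w' e) →
      (∀ e, ¬ (∃ x ∈ X, ∃ y ∈ X, e = s(x, y)) → w e = w' e) →
      setDist G w X b ≤ setDist G w' X b := by
    intro w w' hw hw' h
    have key : ∀ {y c : V} (p : G.Walk y c),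
        (∃ x' ∈ X, ∃ q : G.Walk x' c, (q.edges.map w).sum ≤ (p.edges.map w').sum) ∨
        (y ∉ X ∧ (p.edges.map w).sum = (p.edges.map w').sum) := by
      intro y c p
      induction p with
      | nil =>
        rename_i u
        by_cases hu : u ∈ X
        · exact Or.inl ⟨u, hu, SimpleGraph.Walk.nil, by simp⟩
        · exact Or.inr ⟨hu, by simp⟩
      | cons hyz p ih =>
        rename_i y z c
        rcases ih with ⟨x', hx', q, hq⟩ | ⟨hz, e⟩
        · refine Or.inl ⟨x', hx', q, hq.trans ?_⟩
          have := hw' s(y, z)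
          simp only [SimpleGraph.Walk.edges_cons, List.map_cons, List.sum_cons]
          linarith
        · have hyz' : w s(y, z) = w' s(y, z) := by
            refine h _ ?_
            rintro ⟨x₁, h₁, x₂, h₂, e'⟩
            rw [Sym2.eq_iff] at e'
            rcases e' with ⟨rfl, rfl⟩ | ⟨rfl, rfl⟩
            · exact hz h₂
            · exact hz h₁
          have hsum : ((SimpleGraph.Walk.cons hyz p).edges.map w).sum =
              ((SimpleGraph.Walk.cons hyz p).edges.map w').sum := by
            simp only [SimpleGraph.Walk.edges_cons, List.map_cons, List.sum_cons]
            rw [hyz', e]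
          by_cases hy : y ∈ X
          · exact Or.inl ⟨y, hy, _, hsum.le⟩
          · exact Or.inr ⟨hy, hsum⟩
    refine le_setDist hG hX fun y hy p => ?_
    rcases key p with ⟨x', hx', q, hq⟩ | ⟨hyX, _⟩
    · exact (setDist_le hw hx' q).trans hq
    · exact absurd hy hyX
  exact le_antisymm (main w w' hw hw' h) (main w' w hw' hw fun e he => (h e he).symm)

lemma setHit_congr {G : SimpleGraph V} (hG : G.Preconnected) {X : Finset V} (hX : X.Nonempty)
    {w w' : Sym2 V → ℝ} (hw : ∀ e, 0 ≤ w e) (hw' : ∀ e, 0 ≤ w' e)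
    (h : ∀ e, ¬ (∃ x ∈ X, ∃ y ∈ X, e = s(x, y)) → w e = w' e) (k : ℕ) :
    setHit G w X k = setHit G w' X k := by
  unfold setHit
  simp only [setDist_congr hG hX hw hw' h]

end FirstPassage

section Exponential

set_option linter.unusedSectionVars false

open Set in
lemma lintegral_expMeasure (f : ℝ → ENNReal) (hf : Measurable f) :
    ∫⁻ x, f x ∂expMeasure 1 = ∫⁻ x, exponentialPDF 1 x * f x := by
  have : expMeasure 1 = volume.withDensity (exponentialPDF 1) := rfl
  rw [this, lintegral_withDensity_eq_lintegral_mul _ (by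
    unfold exponentialPDF
    exact (measurable_exponentialPDFReal 1).ennreal_ofReal) hf]
  rfl

lemma lintegral_exp_expMeasure {a : ℝ} (ha : 0 < 1 + a) :
    ∫⁻ m, ENNReal.ofReal (Real.exp (-(a * m))) ∂expMeasure 1 = ENNReal.ofReal (1 / (1 + a)) := by
  rw [lintegral_expMeasure _ (by fun_prop)]
  have h : ∀ m, exponentialPDF 1 m * ENNReal.ofReal (Real.exp (-(a * m))) =
      ENNReal.ofReal (1 / (1 + a)) * exponentialPDF (1 + a) m := by
    intro m
    rcases lt_or_ge m 0 with hm | hm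
    · simp [exponentialPDF_of_neg hm]
    · rw [exponentialPDF_of_nonneg hm, exponentialPDF_of_nonneg hm,
        ← ENNReal.ofReal_mul (by positivity), ← ENNReal.ofReal_mul (by positivity)]
      congr 1
      rw [← mul_assoc, one_div, inv_mul_cancel₀ ha.ne', one_mul, one_mul, one_mul, ← Real.exp_add]
      congr 1
      ring
  simp_rw [h]
  rw [lintegral_const_mul _ (by
    unfold exponentialPDF
    exact (measurable_exponentialPDFReal _).ennreal_ofReal), lintegral_exponentialPDF_eq_one ha,
    mul_one]

instance : IsProbabilityMeasure (expMeasure 1) := isProbabilityMeasure_expMeasure one_pos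

lemma expMeasure_nonneg : ∀ᵐ x ∂expMeasure 1, 0 ≤ x := by
  have h : MeasurableSet {x : ℝ | ¬ 0 ≤ x} := by
    simp only [not_le]
    exact measurableSet_Iio
  rw [ae_iff, ← lintegral_indicator_one h, lintegral_expMeasure _ (measurable_one.indicator h)]
  refine (lintegral_congr fun x => ?_).trans lintegral_zero
  by_cases hx : 0 ≤ x
  · simp [hx]
  · simp [exponentialPDF_of_neg (not_le.1 hx)]

lemma expMeasure_shift {m : ℝ} (hm : 0 ≤ m) {s : Set ℝ} (hs : MeasurableSet s) :
    expMeasure 1 {x | m ≤ x ∧ x - m ∈ s} = ENNReal.ofReal (Real.exp (-m)) * expMeasure 1 s := by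
  have hs' : MeasurableSet {x : ℝ | m ≤ x ∧ x - m ∈ s} :=
    measurableSet_Ici.inter ((measurable_id.sub_const m) hs)
  rw [← lintegral_indicator_one hs', ← lintegral_indicator_one hs,
    lintegral_expMeasure _ (measurable_one.indicator hs'),
    lintegral_expMeasure _ (measurable_one.indicator hs),
    ← lintegral_const_mul' _ _ ENNReal.ofReal_ne_top]
  refine Eq.trans (lintegral_congr fun x => ?_) (lintegral_sub_right_eq_self _ m)
  rcases lt_or_ge (x - m) 0 with hx | hx
  · have : ¬ m ≤ x := by linarith
    simp [exponentialPDF_of_neg hx, this]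
  · have hmx : m ≤ x := by linarith
    rw [exponentialPDF_of_nonneg (hm.trans hmx), exponentialPDF_of_nonneg hx, ← mul_assoc,
      ← ENNReal.ofReal_mul (by positivity)]
    congr 1
    · congr 1
      rw [one_mul, one_mul, one_mul, one_mul, ← Real.exp_add]
      congr 1; ring
    · simp [Set.indicator, hmx]

variable {E : Type*} [Fintype E]

/-- Independent exponential weights of mean one. -/
def expPi (E : Type*) [Fintype E] : Measure (E → ℝ) := Measure.pi fun _ => expMeasure 1

instance : IsProbabilityMeasure (expPi E) := by unfold expPi; infer_instance

lemma expPi_nonneg : ∀ᵐ w ∂expPi E, ∀ e, 0 ≤ w e := by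
  rw [ae_all_iff]
  intro e
  exact (measurePreserving_eval (fun _ : E => expMeasure 1) e).quasiMeasurePreserving.ae
    expMeasure_nonneg

lemma expPi_update (e : E) :
    MeasurePreserving (fun q : ℝ × (E → ℝ) => Function.update q.2 e q.1)
      ((expMeasure 1).prod (expPi E)) (expPi E) := by
  have hmeas : Measurable fun q : ℝ × (E → ℝ) => Function.update q.2 e q.1 := by
    refine measurable_pi_lambda _ fun f => ?_
    by_cases h : f = e
    · subst h; simpa using measurable_fst
    · simp only [Function.update_of_ne h]
      exact (measurable_pi_apply f).comp measurable_snd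
  refine ⟨hmeas, ?_⟩
  symm
  refine Measure.pi_eq fun s hs => ?_
  rw [Measure.map_apply hmeas (MeasurableSet.univ_pi hs)]
  have : (fun q : ℝ × (E → ℝ) => Function.update q.2 e q.1) ⁻¹' Set.pi Set.univ s =
      s e ×ˢ Set.pi Set.univ (Function.update s e Set.univ) := by
    ext ⟨x, w⟩
    simp only [Set.mem_preimage, Set.mem_pi, Set.mem_univ, true_imp_iff, Set.mem_prod]
    constructor
    · intro h
      refine ⟨by simpa using h e, fun f => ?_⟩
      by_cases hf : f = e
      · subst hf; simp
      · simpa [Function.update_of_ne hf] using h f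
    · rintro ⟨h1, h2⟩ f
      by_cases hf : f = e
      · subst hf; simpa using h1
      · simpa [Function.update_of_ne hf] using h2 f
  rw [this, Measure.prod_prod, expPi, Measure.pi_pi,
    ← Finset.mul_prod_erase _ _ (Finset.mem_univ e),
    ← Finset.mul_prod_erase (a := e) (s := Finset.univ) (h := Finset.mem_univ e)]
  simp only [Function.update_self, measure_univ, one_mul]
  congr 1
  refine Finset.prod_congr rfl fun f hf => ?_
  rw [Function.update_of_ne (Finset.ne_of_mem_erase hf)]

/-- Lower the coordinates in `A` by `m`. -/
def lower (A : Finset E) (m : ℝ) (w : E → ℝ) : E → ℝ := fun f => if f ∈ A then w f - m else w f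

lemma measurable_lower (A : Finset E) :
    Measurable fun q : ℝ × (E → ℝ) => lower A q.1 q.2 := by
  refine measurable_pi_lambda _ fun f => ?_
  by_cases h : f ∈ A
  · simp only [lower, h, if_true]
    exact ((measurable_pi_apply f).comp measurable_snd).sub measurable_fst
  · simp only [lower, h, if_false]
    exact (measurable_pi_apply f).comp measurable_snd

lemma expPi_shift (A : Finset E) {m : ℝ} (hm : 0 ≤ m) {T : Set (E → ℝ)} (hT : MeasurableSet T) :
    expPi E {w | (∀ f ∈ A, m ≤ w f) ∧ lower A m w ∈ T} =
      ENNReal.ofReal (Real.exp (-(A.card * m))) * expPi E T := by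
  have hlow : Measurable (lower A m) :=
    (measurable_lower A).comp (measurable_const.prodMk measurable_id)
  set c := ENNReal.ofReal (Real.exp (-m)) with hc
  have hc0 : c ≠ 0 := by simp [hc, Real.exp_pos]
  have hct : c ≠ ⊤ := ENNReal.ofReal_ne_top
  have hR : MeasurableSet {w : E → ℝ | ∀ f ∈ A, m ≤ w f} := by
    have : {w : E → ℝ | ∀ f ∈ A, m ≤ w f} = ⋂ f ∈ A, {w | m ≤ w f} := by ext; simp
    rw [this]
    exact Finset.measurableSet_biInter _ fun f _ =>
      measurableSet_le measurable_const (measurable_pi_apply f)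
  have key : expPi E = (c ^ A.card)⁻¹ •
      (((expPi E).restrict {w | ∀ f ∈ A, m ≤ w f}).map (lower A m)) := by
    refine Measure.pi_eq fun s hs => ?_
    rw [Measure.smul_apply, Measure.map_apply hlow (MeasurableSet.univ_pi hs),
      Measure.restrict_apply (hlow (MeasurableSet.univ_pi hs))]
    have : lower A m ⁻¹' Set.pi Set.univ s ∩ {w | ∀ f ∈ A, m ≤ w f} =
        Set.pi Set.univ fun f => if f ∈ A then {x | m ≤ x ∧ x - m ∈ s f} else s f := by
      ext w
      simp only [Set.mem_inter_iff, Set.mem_preimage, Set.mem_pi, Set.mem_univ, true_imp_iff,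
        Set.mem_ofPred_eq, lower]
      constructor
      · rintro ⟨h1, h2⟩ f
        by_cases hf : f ∈ A
        · simpa [hf] using ⟨h2 f hf, by simpa [hf] using h1 f⟩
        · simpa [hf] using h1 f
      · intro h
        refine ⟨fun f => ?_, fun f hf => ?_⟩
        · by_cases hf : f ∈ A
          · have := h f
            simp only [hf, if_true] at this ⊢
            exact this.2
          · simpa [hf] using h f
        · have := h f
          simp only [hf, if_true] at this
          exact this.1
    rw [this, expPi, Measure.pi_pi]
    have h1 : ∀ f, expMeasure 1 (if f ∈ A then {x | m ≤ x ∧ x - m ∈ s f} else s f) =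
        (if f ∈ A then c else 1) * expMeasure 1 (s f) := by
      intro f
      split_ifs
      · exact expMeasure_shift hm (hs f)
      · rw [one_mul]
    simp_rw [h1, Finset.prod_mul_distrib]
    rw [Finset.prod_ite_mem, Finset.univ_inter, Finset.prod_const, smul_eq_mul, ← mul_assoc,
      ENNReal.inv_mul_cancel (pow_ne_zero _ hc0) (ENNReal.pow_ne_top hct), one_mul]
  have hcA : ENNReal.ofReal (Real.exp (-(A.card * m))) = c ^ A.card := by
    rw [hc, ← ENNReal.ofReal_pow (Real.exp_pos _).le, ← Real.exp_nat_mul]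
    congr 2; ring
  have hT' := congrArg (fun μ => μ T) key
  simp only [Measure.smul_apply] at hT'
  rw [Measure.map_apply hlow hT, Measure.restrict_apply (hlow hT)] at hT'
  rw [hcA, hT', smul_eq_mul, ← mul_assoc,
    ENNReal.mul_inv_cancel (pow_ne_zero _ hc0) (ENNReal.pow_ne_top hct), one_mul]
  congr 1
  ext w
  simp [and_comm]

end Exponential

section Measurability

set_option linter.unusedSectionVars false

variable {V : Type*} [Fintype V]

instance (G : SimpleGraph V) (a b : V) : Countable (G.Walk a b) :=
  Function.Injective.countable (f := fun p : G.Walk a b => p.support)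
    fun _ _ h => SimpleGraph.Walk.ext_support h

lemma measurable_setDist (G : SimpleGraph V) (X : Finset V) (b : V) :
    Measurable fun w => setDist G w X b := by
  have : (fun w => setDist G w X b) =
      fun w : Sym2 V → ℝ => ⨅ q : Σ x : X, G.Walk (x : V) b, (q.2.edges.map w).sum := by
    funext w
    unfold setDist iInf
    congr 1
    ext r
    simp only [Set.mem_ofPred_eq, Set.mem_range, Sigma.exists, Subtype.exists, eq_comm (a := r),
      exists_prop]
  rw [this]
  refine Measurable.iInf fun q => ?_
  have hl : ∀ l : List (Sym2 V), Measurable fun w : Sym2 V → ℝ => (l.map w).sum := by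
    intro l
    induction l with
    | nil => simp
    | cons e l ih =>
      simp only [List.map_cons, List.sum_cons]
      exact (measurable_pi_apply e).add ih
  exact hl _

lemma setHit_le_iff (G : SimpleGraph V) (w : Sym2 V → ℝ) (X : Finset V) {k : ℕ}
    (hk : k ≤ Fintype.card V) (t : ℝ) :
    setHit G w X k ≤ t ↔ 0 ≤ t ∧ k ≤ (Finset.univ.filter fun b => setDist G w X b ≤ t).card := by
  constructor
  · intro h
    have hcl : IsClosed {t : ℝ | 0 ≤ t ∧
        k ≤ (Finset.univ.filter fun b => setDist G w X b ≤ t).card} := by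
      have : {t : ℝ | 0 ≤ t ∧ k ≤ (Finset.univ.filter fun b => setDist G w X b ≤ t).card} =
          Set.Ici 0 ∩ ⋃ S : {S : Finset V // k ≤ S.card}, ⋂ b ∈ (S : Finset V),
            Set.Ici (setDist G w X b) := by
        ext t
        simp only [Set.mem_ofPred_eq, Set.mem_inter_iff, Set.mem_Ici, Set.mem_iUnion,
          Set.mem_iInter]
        refine and_congr_right fun _ => ⟨fun h => ⟨⟨_, h⟩, fun b hb => ?_⟩, ?_⟩
        · simpa using hb
        · rintro ⟨⟨S, hS⟩, h⟩
          exact hS.trans (Finset.card_le_card fun b hb => by simpa using h b hb)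
      rw [this]
      refine isClosed_Ici.inter (isClosed_iUnion_of_finite fun S => ?_)
      exact isClosed_biInter fun b _ => isClosed_Ici
    have hmem := hcl.csInf_mem (setHit_set_nonempty G w X hk) ⟨0, fun _ h => h.1⟩
    change 0 ≤ setHit G w X k ∧
      k ≤ (Finset.univ.filter fun b => setDist G w X b ≤ setHit G w X k).card at hmem
    refine ⟨hmem.1.trans h, hmem.2.trans (Finset.card_le_card fun b hb => ?_)⟩
    simp only [Finset.mem_filter, Finset.mem_univ, true_and] at hb ⊢
    exact hb.trans h
  · exact fun h => csInf_le ⟨0, fun _ h => h.1⟩ h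

lemma measurable_setHit (G : SimpleGraph V) (X : Finset V) {k : ℕ}
    (hk : k ≤ Fintype.card V) : Measurable fun w => setHit G w X k := by
  refine measurable_of_Iic fun t => ?_
  have : (fun w => setHit G w X k) ⁻¹' Set.Iic t =
      ⋃ S : {S : Finset V // k ≤ S.card}, {w | 0 ≤ t} ∩ ⋂ b ∈ (S : Finset V),
        {w | setDist G w X b ≤ t} := by
    ext w
    simp only [Set.mem_preimage, Set.mem_Iic, setHit_le_iff G w X hk, Set.mem_iUnion,
      Set.mem_inter_iff, Set.mem_iInter, Set.mem_ofPred_eq]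
    constructor
    · rintro ⟨h0, h⟩
      exact ⟨⟨_, h⟩, h0, fun b hb => by simpa using hb⟩
    · rintro ⟨⟨S, hS⟩, h0, h⟩
      exact ⟨h0, hS.trans (Finset.card_le_card fun b hb => by simpa using h b hb)⟩
  rw [this]
  refine MeasurableSet.iUnion fun S => MeasurableSet.inter (by simp) ?_
  exact Finset.measurableSet_biInter _ fun b _ => (measurable_setDist G X b) measurableSet_Iic

end Measurability

section Recursion

set_option linter.unusedSectionVars false

variable {V : Type*} [Fintype V]

/-- Weights for which the ball around `X` needs time at least `s` to grow from `k₁` to `k₂`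
vertices. -/
def slowSet (G : SimpleGraph V) (k₁ k₂ : ℕ) (X : Finset V) (s : ℝ) : Set (Sym2 V → ℝ) :=
  {w | (∀ e, 0 ≤ w e) ∧ s ≤ setHit G w X k₂ - setHit G w X k₁}

lemma measurableSet_slowSet (G : SimpleGraph V) {k₁ k₂ : ℕ} (h₁ : k₁ ≤ Fintype.card V)
    (h₂ : k₂ ≤ Fintype.card V) (X : Finset V) :
    MeasurableSet {q : ℝ × (Sym2 V → ℝ) | q.2 ∈ slowSet G k₁ k₂ X q.1} := by
  have : {q : ℝ × (Sym2 V → ℝ) | q.2 ∈ slowSet G k₁ k₂ X q.1} =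
      (⋂ e, {q | 0 ≤ q.2 e}) ∩ {q | q.1 ≤ setHit G q.2 X k₂ - setHit G q.2 X k₁} := by
    ext q
    simp [slowSet]
  rw [this]
  refine (MeasurableSet.iInter fun e => measurableSet_le measurable_const
    (by fun_prop)).inter ?_
  exact measurableSet_le measurable_fst (((measurable_setHit G X h₂).comp measurable_snd).sub
    ((measurable_setHit G X h₁).comp measurable_snd))

lemma slowSet_step {G : SimpleGraph V} (hG : G.Preconnected) {k₁ k₂ : ℕ} (h₁₂ : k₁ ≤ k₂)
    (h₂ : k₂ ≤ Fintype.card V) {X : Finset V} (hX : X.card < k₂)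
    {δ : ℝ} (hδ : δ = if k₁ ≤ X.card then 1 else 0) {x v : V} (hx : x ∈ X) (hv : v ∉ X)
    (hxv : G.Adj x v) {s m : ℝ} {w : Sym2 V → ℝ} (hw0 : ∀ e, 0 ≤ w e)
    (hw : Function.update w s(x, v) m ∈ slowSet G k₁ k₂ X s)
    (hmin : ∀ f ∈ bdryEdges G X, m ≤ Function.update w s(x, v) m f) :
    0 ≤ m ∧ (∀ f ∈ (bdryEdges G X).erase s(x, v), m ≤ w f) ∧
      lower ((bdryEdges G X).erase s(x, v)) m w ∈ slowSet G k₁ k₂ (insert v X) (s - δ * m) := by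
  set u := Function.update w s(x, v) m with hu
  have hue : u s(x, v) = m := by simp [hu]
  have huf : ∀ f, f ≠ s(x, v) → u f = w f := fun f hf => by simp [hu, hf]
  have hu0 := hw.1
  have hA : ∀ f ∈ (bdryEdges G X).erase s(x, v), m ≤ w f := fun f hf => by
    rw [← huf f (Finset.ne_of_mem_erase hf)]
    exact hmin f (Finset.mem_of_mem_erase hf)
  have hlow : ∀ e, 0 ≤ lower ((bdryEdges G X).erase s(x, v)) m w e := by
    intro e
    unfold lower
    split_ifs with h
    · linarith [hA e h]
    · exact hw0 e
  have hmin' : ∀ f ∈ bdryEdges G X, u s(x, v) ≤ u f := by rwa [hue]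
  have hres : ∀ e, 0 ≤ residual G X (u s(x, v)) u e := residual_nonneg hu0 hmin'
  have hcongr : ∀ k, setHit G (residual G X (u s(x, v)) u) (insert v X) k =
      setHit G (lower ((bdryEdges G X).erase s(x, v)) m w) (insert v X) k := by
    intro k
    refine setHit_congr hG (Finset.insert_nonempty v X) hres hlow (fun e he => ?_) k
    have hne : e ≠ s(x, v) := fun h => he ⟨x, by simp [hx], v, by simp, h⟩
    rw [residual, lower, hue, huf e hne]
    simp [hne]
  have hm : 0 ≤ m := hue ▸ hu0 _
  refine ⟨hm, hA, hlow, ?_⟩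
  have hs := hw.2
  rw [setHit_residual hG hu0 hx hv hxv hmin' hX h₂, hcongr, hue] at hs
  by_cases hk : k₁ ≤ X.card
  · rw [setHit_eq_zero hu0 hk] at hs
    rw [setHit_eq_zero hlow (hk.trans (Finset.card_le_card (Finset.subset_insert v X)))]
    rw [hδ, if_pos hk]
    linarith
  · rw [setHit_residual hG hu0 hx hv hxv hmin' (not_le.1 hk) (h₁₂.trans h₂), hcongr, hue] at hs
    rw [hδ, if_neg hk]
    linarith

lemma exists_min_bdryEdges {G : SimpleGraph V} {X : Finset V} (hb : bdry G X ≠ 0)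
    (w : Sym2 V → ℝ) :
    ∃ v ∈ Xᶜ, ∃ x ∈ X, G.Adj v x ∧ ∀ f ∈ bdryEdges G X, w s(x, v) ≤ w f := by
  have hne : (bdryEdges G X).Nonempty := by
    rw [← Finset.card_pos, card_bdryEdges]
    omega
  obtain ⟨e, he, hmin⟩ := (bdryEdges G X).exists_min_image w hne
  have he' := he
  simp only [bdryEdges, Finset.mem_filter, Finset.mem_univ, true_and] at he'
  obtain ⟨x, hx, v, hv, hxv, rfl⟩ := he'
  exact ⟨v, by simpa using hv, x, hx, hxv.symm, hmin⟩

lemma measure_slowSet_edge {G : SimpleGraph V} (hG : G.Preconnected) {k₁ k₂ : ℕ}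
    (h₁₂ : k₁ ≤ k₂) (h₂ : k₂ ≤ Fintype.card V) {X : Finset V} (hX : X.card < k₂)
    {δ t a b : ℝ} (hδ : δ = if k₁ ≤ X.card then 1 else 0) (ha : 0 ≤ a) (hb : 0 ≤ b)
    (hS : 0 < bdry G X - δ * t) {x v : V} (hx : x ∈ X) (hv : v ∉ X)
    (hxv : G.Adj x v)
    (hrec : ∀ s, expPi (Sym2 V) (slowSet G k₁ k₂ (insert v X) s) ≤
      ENNReal.ofReal (a * Real.exp (-(t * s)) + b)) (s : ℝ) :
    expPi (Sym2 V) {w | w ∈ slowSet G k₁ k₂ X s ∧ ∀ f ∈ bdryEdges G X, w s(x, v) ≤ w f} ≤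
      ENNReal.ofReal (a * Real.exp (-(t * s)) / (bdry G X - δ * t) + b / bdry G X) := by
  set e := s(x, v) with he
  set A := (bdryEdges G X).erase e with hA
  have hemem : e ∈ bdryEdges G X := (mem_bdryEdges hxv).2 (by tauto)
  have hbpos : 0 < bdry G X := by
    rw [← card_bdryEdges]
    exact Finset.card_pos.2 ⟨e, hemem⟩
  have hAcard : (A.card : ℝ) = bdry G X - 1 := by
    rw [hA, Finset.card_erase_of_mem hemem, card_bdryEdges, Nat.cast_sub (by omega)]
    simp
  have hk₁ := h₁₂.trans h₂
  have hmono : MeasurableSet {w : Sym2 V → ℝ | w ∈ slowSet G k₁ k₂ X s ∧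
      ∀ f ∈ bdryEdges G X, w s(x, v) ≤ w f} := by
    have : {w : Sym2 V → ℝ | w ∈ slowSet G k₁ k₂ X s ∧
        ∀ f ∈ bdryEdges G X, w s(x, v) ≤ w f} =
        ((fun w => (s, w)) ⁻¹' {q : ℝ × (Sym2 V → ℝ) | q.2 ∈ slowSet G k₁ k₂ X q.1}) ∩
          ⋂ f ∈ bdryEdges G X, {w | w s(x, v) ≤ w f} := by
      ext w; simp
    rw [this]
    refine ((measurableSet_slowSet G hk₁ h₂ X).preimage (by fun_prop)).inter ?_
    exact Finset.measurableSet_biInter _ fun f _ =>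
      measurableSet_le (measurable_pi_apply _) (measurable_pi_apply f)
  set T : Set (ℝ × (Sym2 V → ℝ)) := {q | 0 ≤ q.1 ∧ (∀ f ∈ A, q.1 ≤ q.2 f) ∧
    lower A q.1 q.2 ∈ slowSet G k₁ k₂ (insert v X) (s - δ * q.1)} with hT
  have hTm : MeasurableSet T := by
    have : T = {q | 0 ≤ q.1} ∩ ((⋂ f ∈ A, {q | q.1 ≤ q.2 f}) ∩
        (fun q : ℝ × (Sym2 V → ℝ) => (s - δ * q.1, lower A q.1 q.2)) ⁻¹'
          {q : ℝ × (Sym2 V → ℝ) | q.2 ∈ slowSet G k₁ k₂ (insert v X) q.1}) := by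
      ext q; simp [hT]
    rw [this]
    refine (measurableSet_le measurable_const measurable_fst).inter (MeasurableSet.inter ?_ ?_)
    · exact Finset.measurableSet_biInter _ fun f _ =>
        measurableSet_le measurable_fst ((measurable_pi_apply f).comp measurable_snd)
    · refine (measurableSet_slowSet G hk₁ h₂ (insert v X)).preimage ?_
      exact (measurable_const.sub (measurable_fst.const_mul δ)).prodMk (measurable_lower A)
  have hsub : expPi (Sym2 V) {w | w ∈ slowSet G k₁ k₂ X s ∧
      ∀ f ∈ bdryEdges G X, w s(x, v) ≤ w f} ≤ ((expMeasure 1).prod (expPi (Sym2 V))) T := by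
    rw [← (expPi_update e).measure_preimage hmono.nullMeasurableSet]
    refine measure_mono_ae ?_
    have hae : ∀ᵐ q : ℝ × (Sym2 V → ℝ) ∂((expMeasure 1).prod (expPi (Sym2 V))),
        ∀ f, 0 ≤ q.2 f := Measure.quasiMeasurePreserving_snd.ae expPi_nonneg
    filter_upwards [hae] with q hq hmem
    have h1 : Function.update q.2 s(x, v) q.1 ∈ slowSet G k₁ k₂ X s := by
      convert! hmem.1
    have h2 : ∀ f ∈ bdryEdges G X, q.1 ≤ Function.update q.2 s(x, v) q.1 f := by
      intro f hf
      have := hmem.2 f hf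
      simp only [← he, Function.update_self] at this
      convert! this
    exact slowSet_step hG h₁₂ h₂ hX hδ hx hv hxv hq h1 h2
  refine hsub.trans ?_
  rw [Measure.prod_apply hTm]
  have hfib : ∀ m, expPi (Sym2 V) (Prod.mk m ⁻¹' T) ≤
      ENNReal.ofReal (a * Real.exp (-(t * s))) *
        ENNReal.ofReal (Real.exp (-((bdry G X - 1 - δ * t) * m))) +
      ENNReal.ofReal b * ENNReal.ofReal (Real.exp (-((bdry G X - 1) * m))) := by
    intro m
    by_cases hm : 0 ≤ m
    · have hTm' : MeasurableSet (slowSet G k₁ k₂ (insert v X) (s - δ * m)) :=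
        (measurableSet_slowSet G hk₁ h₂ (insert v X)).preimage
          (f := fun w => (s - δ * m, w)) (by fun_prop)
      have : Prod.mk m ⁻¹' T = {w | (∀ f ∈ A, m ≤ w f) ∧
          lower A m w ∈ slowSet G k₁ k₂ (insert v X) (s - δ * m)} := by
        ext w; simp [hT, hm]
      rw [this, expPi_shift A hm hTm']
      refine (mul_le_mul_right (hrec _) _).trans ?_
      rw [← ENNReal.ofReal_mul (Real.exp_pos _).le, ← ENNReal.ofReal_mul (by positivity),
        ← ENNReal.ofReal_mul hb, ← ENNReal.ofReal_add (by positivity) (by positivity)]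
      refine ENNReal.ofReal_le_ofReal (le_of_eq ?_)
      rw [hAcard, mul_add, mul_comm _ b]
      congr 1
      rw [mul_left_comm, mul_assoc, ← Real.exp_add, ← Real.exp_add]
      congr 2; ring
    · have : Prod.mk m ⁻¹' T = ∅ := by
        ext w; simp [hT, hm]
      rw [this, measure_empty]
      exact zero_le
  have hbR : (0 : ℝ) < bdry G X := by exact_mod_cast hbpos
  refine (lintegral_mono hfib).trans ?_
  rw [lintegral_add_left (by fun_prop), lintegral_const_mul _ (by fun_prop),
    lintegral_const_mul _ (by fun_prop), lintegral_exp_expMeasure (by linarith),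
    lintegral_exp_expMeasure (by linarith), ← ENNReal.ofReal_mul (by positivity),
    ← ENNReal.ofReal_mul hb, ← ENNReal.ofReal_add]
  · refine ENNReal.ofReal_le_ofReal (le_of_eq ?_)
    rw [show (1 : ℝ) + (bdry G X - 1 - δ * t) = bdry G X - δ * t by ring,
      show (1 : ℝ) + (bdry G X - 1) = bdry G X by ring]
    ring
  · exact mul_nonneg (by positivity) (by
      rw [show (1 : ℝ) + (bdry G X - 1 - δ * t) = bdry G X - δ * t by ring]
      positivity)
  · exact mul_nonneg hb (by
      rw [show (1 : ℝ) + (bdry G X - 1) = bdry G X by ring]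
      positivity)

lemma measure_slowSet_step {G : SimpleGraph V} (hG : G.Preconnected) {k₁ k₂ : ℕ}
    (h₁₂ : k₁ ≤ k₂) (h₂ : k₂ ≤ Fintype.card V) {X : Finset V} (hX : X.card < k₂)
    {δ t a : ℝ} {b : Finset V → ℝ} (hδ : δ = if k₁ ≤ X.card then 1 else 0) (ha : 0 ≤ a)
    (hb : ∀ Y, 0 ≤ b Y) (hS0 : bdry G X ≠ 0) (hS : 0 < bdry G X - δ * t)
    (hrec : ∀ v ∉ X, ∀ s, expPi (Sym2 V) (slowSet G k₁ k₂ (insert v X) s) ≤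
      ENNReal.ofReal (a * Real.exp (-(t * s)) + b (insert v X))) (s : ℝ) :
    expPi (Sym2 V) (slowSet G k₁ k₂ X s) ≤
      ENNReal.ofReal (a * (bdry G X / (bdry G X - δ * t)) * Real.exp (-(t * s)) +
        stepAvg G X b) := by
  have hbR : (0 : ℝ) < bdry G X := by exact_mod_cast Nat.pos_of_ne_zero hS0
  have hcov : slowSet G k₁ k₂ X s ⊆ ⋃ v ∈ Xᶜ, ⋃ x ∈ X.filter fun x => G.Adj v x,
      {w | w ∈ slowSet G k₁ k₂ X s ∧ ∀ f ∈ bdryEdges G X, w s(x, v) ≤ w f} := by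
    intro w hw
    obtain ⟨v, hv, x, hx, hvx, hmin⟩ := exists_min_bdryEdges hS0 w
    simp only [Set.mem_iUnion]
    exact ⟨v, hv, x, by simp [hx, hvx], hw, hmin⟩
  refine (measure_mono hcov).trans ((measure_biUnion_finset_le _ _).trans ?_)
  have hv : ∀ v ∈ Xᶜ, expPi (Sym2 V) (⋃ x ∈ X.filter fun x => G.Adj v x,
      {w | w ∈ slowSet G k₁ k₂ X s ∧ ∀ f ∈ bdryEdges G X, w s(x, v) ≤ w f}) ≤
      ENNReal.ofReal (nbrCount G X v * (a * Real.exp (-(t * s)) / (bdry G X - δ * t) +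
        b (insert v X) / bdry G X)) := by
    intro v hv
    have hv' := Finset.mem_compl.1 hv
    refine (measure_biUnion_finset_le _ _).trans ?_
    refine (Finset.sum_le_card_nsmul _ _ (ENNReal.ofReal (a * Real.exp (-(t * s)) /
      (bdry G X - δ * t) + b (insert v X) / bdry G X)) fun x hx => ?_).trans ?_
    · obtain ⟨hx, hvx⟩ := Finset.mem_filter.1 hx
      exact measure_slowSet_edge hG h₁₂ h₂ hX hδ ha (hb _) hS hx hv' hvx.symm (hrec v hv') s
    · rw [nsmul_eq_mul, ENNReal.ofReal_mul (Nat.cast_nonneg _), ENNReal.ofReal_natCast]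
      exact le_rfl
  refine (Finset.sum_le_sum hv).trans ?_
  rw [← ENNReal.ofReal_sum_of_nonneg fun v _ => mul_nonneg (Nat.cast_nonneg _)
    (add_nonneg (by positivity) (div_nonneg (hb _) hbR.le))]
  refine ENNReal.ofReal_le_ofReal (le_of_eq ?_)
  simp only [mul_add, Finset.sum_add_distrib, stepAvg]
  congr 1
  · rw [← Finset.sum_mul]
    have : ∑ v ∈ Xᶜ, (nbrCount G X v : ℝ) = bdry G X := by rw [bdry]; push_cast; rfl
    rw [this]; ring
  · exact Finset.sum_congr rfl fun v _ => by ring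

end Recursion

section Growth

set_option linter.unusedSectionVars false

variable {V : Type*} [Fintype V]

/-- A set of at least `k₁` vertices with few outgoing edges. -/
def badGrowth (c : ℝ) (k₁ : ℕ) : SimpleGraph V → Finset V → Prop :=
  fun G X => k₁ ≤ X.card ∧ (bdry G X : ℝ) < c * X.card

/-- A union of components with at least four vertices. -/
def badClosed : SimpleGraph V → Finset V → Prop :=
  fun G X => 4 ≤ X.card ∧ bdry G X = 0

/-- A set with at least `q` outgoing edges. -/
def largeBdry (q : ℕ) : SimpleGraph V → Finset V → Prop := fun G X => q ≤ bdry G X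

lemma not_adj_of_bdry_eq_zero {G : SimpleGraph V} {X : Finset V} (h : bdry G X = 0) :
    ∀ x ∈ X, ∀ v ∉ X, ¬ G.Adj v x := by
  intro x hx v hv hvx
  have := (Finset.sum_eq_zero_iff.1 h) v (Finset.mem_compl.2 hv)
  rw [nbrCount, Finset.card_eq_zero, Finset.filter_eq_empty_iff] at this
  exact this hx hvx

lemma bdry_eq_zero_of_not_adj {G : SimpleGraph V} {X : Finset V}
    (h : ∀ x ∈ X, ∀ v ∉ X, ¬ G.Adj v x) : bdry G X = 0 := by
  refine Finset.sum_eq_zero fun v hv => ?_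
  rw [nbrCount, Finset.card_eq_zero, Finset.filter_eq_empty_iff]
  exact fun x hx => h x hx v (Finset.mem_compl.1 hv)

lemma bdry_ne_zero_of_preconnected {G : SimpleGraph V} (hG : G.Preconnected) {X : Finset V}
    (hX : X.Nonempty) (hX' : X.card < Fintype.card V) : bdry G X ≠ 0 := by
  intro h
  obtain ⟨x, hx⟩ := hX
  have key : ∀ {y z : V} (p : G.Walk y z), y ∈ X → z ∈ X := by
    intro y z p
    induction p with
    | nil => exact id
    | cons hyz p ih =>
      intro hy
      refine ih ?_
      by_contra hz
      exact not_adj_of_bdry_eq_zero h _ hy _ hz hyz.symm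
  have : X = Finset.univ := by
    ext z
    obtain ⟨p⟩ := hG x z
    simp [key p hx]
  rw [this, Finset.card_univ] at hX'
  exact lt_irrefl _ hX'

lemma div_sub_mul_pow_le {k K ℓ : ℕ} (hk : ℓ < k) (hK : ℓ < K) {c S : ℝ} (hc : 0 < c)
    (hS : c * k ≤ S) :
    (((K : ℝ) - ℓ) / (((k + 1 : ℕ) : ℝ) - ℓ)) ^ ℓ * (S / (S - 1 * (c * ℓ))) ≤
      (((K : ℝ) - ℓ) / ((k : ℝ) - ℓ)) ^ ℓ := by
  have hk' : (0 : ℝ) < (k : ℝ) - ℓ := by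
    rw [sub_pos]; exact_mod_cast hk
  have hK' : (0 : ℝ) < (K : ℝ) - ℓ := by
    rw [sub_pos]; exact_mod_cast hK
  have hk1 : (0 : ℝ) < ((k + 1 : ℕ) : ℝ) - ℓ := by push_cast; linarith
  have hS' : 0 < S - 1 * (c * ℓ) := by nlinarith
  have h1 : S / (S - 1 * (c * ℓ)) ≤ k / ((k : ℝ) - ℓ) := by
    rw [div_le_div_iff₀ hS' hk']
    have : (0 : ℝ) ≤ ℓ := Nat.cast_nonneg _
    nlinarith
  have h2 : (k : ℝ) / ((k : ℝ) - ℓ) ≤ ((((k + 1 : ℕ) : ℝ) - ℓ) / ((k : ℝ) - ℓ)) ^ ℓ := by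
    have := one_add_mul_le_pow (a := 1 / ((k : ℝ) - ℓ)) (by
      have : 0 < 1 / ((k : ℝ) - ℓ) := by positivity
      linarith) ℓ
    have e1 : (k : ℝ) / ((k : ℝ) - ℓ) = 1 + ℓ * (1 / ((k : ℝ) - ℓ)) := by
      field_simp; ring
    have e2 : (((k + 1 : ℕ) : ℝ) - ℓ) / ((k : ℝ) - ℓ) = 1 + 1 / ((k : ℝ) - ℓ) := by
      push_cast; field_simp; ring
    rw [e1, e2]; exact this
  calc _ ≤ (((K : ℝ) - ℓ) / (((k + 1 : ℕ) : ℝ) - ℓ)) ^ ℓ *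
        ((((k + 1 : ℕ) : ℝ) - ℓ) / ((k : ℝ) - ℓ)) ^ ℓ :=
        mul_le_mul_of_nonneg_left (h1.trans h2) (by positivity)
    _ = _ := by
        rw [← mul_pow]
        congr 1
        field_simp

lemma measure_slowSet_le {G : SimpleGraph V} (hG : G.Preconnected) {k₁ k₂ ℓ : ℕ}
    (hℓ : ℓ < k₁) (h₁₂ : k₁ ≤ k₂) (h₂ : k₂ ≤ Fintype.card V) {c : ℝ} (hc : 0 < c) (f : ℕ) :
    ∀ X : Finset V, X.Nonempty → X.card ≤ k₂ → k₂ ≤ X.card + f → ∀ s,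
      expPi (Sym2 V) (slowSet G k₁ k₂ X s) ≤
        ENNReal.ofReal ((((k₂ : ℝ) - ℓ) / ((max X.card k₁ : ℕ) - ℓ)) ^ ℓ *
          Real.exp (-(c * ℓ * s)) + badProb (badGrowth c k₁) (fun _ _ => False) G f X) := by
  have hend : ∀ (f : ℕ) (X : Finset V), X.card = k₂ → ∀ s,
      expPi (Sym2 V) (slowSet G k₁ k₂ X s) ≤
        ENNReal.ofReal ((((k₂ : ℝ) - ℓ) / ((max X.card k₁ : ℕ) - ℓ)) ^ ℓ *
          Real.exp (-(c * ℓ * s)) + badProb (badGrowth c k₁) (fun _ _ => False) G f X) := by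
    intro f X hX s
    have hk : (0 : ℝ) < (k₂ : ℝ) - ℓ := by
      rw [sub_pos]; exact_mod_cast hℓ.trans_le h₁₂
    rw [hX, max_eq_left h₁₂, div_self hk.ne', one_pow, one_mul]
    by_cases hs : s ≤ 0
    · refine prob_le_one.trans ?_
      rw [ENNReal.one_le_ofReal]
      have : 0 ≤ -(c * ℓ * s) := by
        have : 0 ≤ c * ℓ := by positivity
        nlinarith
      have := Real.one_le_exp this
      have := badProb_nonneg (bad := badGrowth c k₁) (halt := fun _ _ => False) G f X
      linarith
    · have : slowSet G k₁ k₂ X s = ∅ := by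
        ext w
        simp only [slowSet, Set.mem_ofPred_eq, Set.mem_empty_iff_false, iff_false, not_and]
        intro hw
        rw [setHit_eq_zero hw hX.ge, setHit_eq_zero hw (h₁₂.trans hX.ge)]
        simpa using hs
      rw [this, measure_empty]
      exact zero_le
  induction f with
  | zero => exact fun X _ h1 h2 s => hend 0 X (by omega) s
  | succ f ih =>
    intro X hne h1 h2 s
    rcases h1.eq_or_lt with hX | hX
    · exact hend _ X hX s
    rw [badProb]
    by_cases hbad : badGrowth c k₁ G X
    · rw [if_pos hbad]
      refine prob_le_one.trans ?_
      rw [ENNReal.one_le_ofReal, le_add_iff_nonneg_left]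
      refine mul_nonneg (pow_nonneg (div_nonneg ?_ ?_) _) (Real.exp_pos _).le
      · rw [sub_nonneg]; exact_mod_cast (hℓ.trans_le h₁₂).le
      · rw [sub_nonneg]; exact_mod_cast hℓ.le.trans (le_max_right _ _)
    rw [if_neg hbad, if_neg not_false]
    have hS0 := bdry_ne_zero_of_preconnected hG hne (hX.trans_le h₂)
    have hSpos : (0 : ℝ) < bdry G X := by exact_mod_cast Nat.pos_of_ne_zero hS0
    have hcard : ∀ v ∉ X, (insert v X).card = X.card + 1 :=
      fun v hv => Finset.card_insert_of_notMem hv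
    have hrec : ∀ v ∉ X, ∀ s, expPi (Sym2 V) (slowSet G k₁ k₂ (insert v X) s) ≤
        ENNReal.ofReal ((((k₂ : ℝ) - ℓ) / ((max (X.card + 1) k₁ : ℕ) - ℓ)) ^ ℓ *
          Real.exp (-(c * ℓ * s)) +
            badProb (badGrowth c k₁) (fun _ _ => False) G f (insert v X)) := by
      intro v hv s
      have := ih (insert v X) (Finset.insert_nonempty _ _) (by rw [hcard v hv]; omega)
        (by rw [hcard v hv]; omega) s
      rwa [hcard v hv] at this
    have hA : 0 ≤ (((k₂ : ℝ) - ℓ) / ((max (X.card + 1) k₁ : ℕ) - ℓ)) ^ ℓ := by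
      refine pow_nonneg (div_nonneg ?_ ?_) _
      · rw [sub_nonneg]; exact_mod_cast (hℓ.trans_le h₁₂).le
      · rw [sub_nonneg]; exact_mod_cast hℓ.le.trans (le_max_right _ _)
    by_cases hk : k₁ ≤ X.card
    · have hSc : c * X.card ≤ bdry G X := by
        by_contra h
        exact hbad ⟨hk, not_le.1 h⟩
      have hpos : (0 : ℝ) < bdry G X - 1 * (c * ℓ) := by
        have : (ℓ : ℝ) < X.card := by exact_mod_cast hℓ.trans_le hk
        nlinarith
      refine (measure_slowSet_step hG h₁₂ h₂ hX (if_pos hk).symm hA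
        (fun Y => badProb_nonneg G f Y) hS0 hpos hrec s).trans
        (ENNReal.ofReal_le_ofReal ?_)
      rw [max_eq_left (hk.trans (Nat.le_succ _)), max_eq_left hk]
      gcongr
      exact div_sub_mul_pow_le (hℓ.trans_le hk) (hℓ.trans_le h₁₂) hc hSc
    · refine (measure_slowSet_step hG h₁₂ h₂ hX (if_neg hk).symm hA
        (fun Y => badProb_nonneg G f Y) hS0 (by simpa using hSpos) hrec s).trans
        (ENNReal.ofReal_le_ofReal ?_)
      rw [max_eq_right (by omega), max_eq_right (by omega), zero_mul, sub_zero,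
        div_self hSpos.ne', mul_one]

lemma badProb_of_small_closed {d : V → ℕ} {G : SimpleGraph V} (hG : G ∈ degGraphs d)
    (hd : ∀ v, 3 ≤ d v) {k₁ k₂ : ℕ} {c : ℝ} (hc : 0 < c)
    (h : ∃ K : Finset V, K.Nonempty ∧ bdry G K = 0 ∧ K.card < k₂) :
    1 ≤ ∑ b : V, (badProb (badGrowth c k₁) (fun _ _ => False) G k₂ {b} +
      badProb badClosed (largeBdry (k₁ ^ 2)) G k₁ {b}) := by
  obtain ⟨K, hK, hKmin⟩ := (Finset.univ.filter fun K : Finset V =>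
    K.Nonempty ∧ bdry G K = 0 ∧ K.card < k₂).exists_min_image Finset.card (by
      obtain ⟨K, hK⟩ := h
      exact ⟨K, by simpa using hK⟩)
  obtain ⟨hKne, hK0, hKk⟩ : K.Nonempty ∧ bdry G K = 0 ∧ K.card < k₂ := by simpa using hK
  have hmin : ∀ X ⊆ K, X.Nonempty → X ≠ K → bdry G X ≠ 0 := by
    intro X hXK hX hne h0
    have hlt := Finset.card_lt_card (hXK.ssubset_of_ne hne)
    have := hKmin X (by simp [hX, h0, hlt.trans hKk])
    omega
  have hclosed := not_adj_of_bdry_eq_zero hK0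
  obtain ⟨b, hb⟩ := hKne
  refine le_trans ?_ (Finset.single_le_sum (fun b _ => add_nonneg (badProb_nonneg G _ {b})
    (badProb_nonneg G _ {b})) (Finset.mem_univ b))
  by_cases hk : k₁ ≤ K.card
  · have hpos : (0 : ℝ) < K.card := by exact_mod_cast Finset.card_pos.2 ⟨b, hb⟩
    have := badProb_eq_one_of_closed (bad := badGrowth c k₁) (halt := fun _ _ => False) hmin
      hclosed ⟨hk, by rw [hK0]; simpa using mul_pos hc hpos⟩ (fun _ _ h => h.elim) k₂ {b}
      (by simpa using hb) (Finset.singleton_nonempty b) (by simp; omega)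
    rw [this]
    linarith [badProb_nonneg (bad := badClosed) (halt := largeBdry (k₁ ^ 2)) G k₁ {b}]
  · have h4 : 4 ≤ K.card := by
      have hsub : insert b (G.neighborFinset b) ⊆ K := by
        intro y hy
        rcases Finset.mem_insert.1 hy with rfl | hy
        · exact hb
        · by_contra hyK
          exact hclosed b hb y hyK ((G.mem_neighborFinset b y).1 hy).symm
      have := Finset.card_le_card hsub
      rw [Finset.card_insert_of_notMem (by simp), SimpleGraph.card_neighborFinset_eq_degree,
        (mem_degGraphs.1 hG) b] at this
      have := hd b
      omega
    have hhalt : ∀ X ⊆ K, largeBdry (k₁ ^ 2) G X → badClosed G X := by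
      intro X hXK hl
      exfalso
      have : bdry G X ≤ K.card * K.card := by
        calc bdry G X = ∑ v ∈ Xᶜ, nbrCount G X v := rfl
          _ ≤ ∑ v ∈ Xᶜ, if v ∈ K then K.card else 0 := by
            refine Finset.sum_le_sum fun v _ => ?_
            split_ifs with hv
            · exact (Finset.card_filter_le _ _).trans (Finset.card_le_card hXK)
            · rw [Nat.le_zero, nbrCount, Finset.card_eq_zero, Finset.filter_eq_empty_iff]
              exact fun x hx => hclosed x (hXK hx) v hv
          _ ≤ ∑ v : V, if v ∈ K then K.card else 0 :=
            Finset.sum_le_sum_of_subset (Finset.subset_univ _)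
          _ = K.card * K.card := by simp
      have h2 : k₁ ^ 2 ≤ bdry G X := hl
      nlinarith
    have := badProb_eq_one_of_closed (bad := badClosed) (halt := largeBdry (k₁ ^ 2)) hmin
      hclosed ⟨h4, hK0⟩ hhalt k₁ {b} (by simpa using hb) (Finset.singleton_nonempty b)
      (by simp; omega)
    rw [this]
    linarith [badProb_nonneg (bad := badGrowth c k₁) (halt := fun _ _ => False) G k₂ {b}]

lemma measure_slowSet_singleton_le {d : V → ℕ} {G : SimpleGraph V} (hG : G ∈ degGraphs d)
    (hd : ∀ v, 3 ≤ d v) {k₁ k₂ ℓ : ℕ} (hℓ : ℓ < k₁) (h₁₂ : k₁ ≤ k₂) {c s : ℝ} (hc : 0 < c)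
    (hs : 0 < s) (a : V) :
    expPi (Sym2 V) (slowSet G k₁ k₂ {a} s) ≤
      ENNReal.ofReal ((((k₂ : ℝ) - ℓ) / ((k₁ : ℝ) - ℓ)) ^ ℓ * Real.exp (-(c * ℓ * s)) +
        ∑ b : V, (badProb (badGrowth c k₁) (fun _ _ => False) G k₂ {b} +
          badProb badClosed (largeBdry (k₁ ^ 2)) G k₁ {b})) := by
  have hR : 0 ≤ (((k₂ : ℝ) - ℓ) / ((k₁ : ℝ) - ℓ)) ^ ℓ * Real.exp (-(c * ℓ * s)) := by
    refine mul_nonneg (pow_nonneg (div_nonneg ?_ ?_) _) (Real.exp_pos _).le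
    · rw [sub_nonneg]; exact_mod_cast (hℓ.trans_le h₁₂).le
    · rw [sub_nonneg]; exact_mod_cast hℓ.le
  by_cases h : ∃ K : Finset V, K.Nonempty ∧ bdry G K = 0 ∧ K.card < k₂
  · refine prob_le_one.trans ?_
    rw [ENNReal.one_le_ofReal]
    have := badProb_of_small_closed hG hd (k₁ := k₁) hc h
    linarith
  push Not at h
  by_cases hU : (Finset.univ.filter fun b => ¬ G.Reachable a b).Nonempty
  · have hcard := h _ hU (bdry_eq_zero_of_not_adj (by
      intro x hx v hv hvx
      simp only [Finset.mem_filter, Finset.mem_univ, true_and, not_not] at hx hv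
      exact hx (hv.trans hvx.reachable)))
    have : slowSet G k₁ k₂ {a} s = ∅ := by
      ext w
      simp only [slowSet, Set.mem_ofPred_eq, Set.mem_empty_iff_false, iff_false, not_and, not_le]
      intro hw
      rw [setHit_eq_zero_of_card_le (hcard.trans (Finset.card_le_card fun b hb => ?_))]
      · linarith [setHit_nonneg G w {a} k₁]
      · simp only [Finset.mem_filter, Finset.mem_univ, true_and] at hb ⊢
        have : setDist G w {a} b = 0 := by
          rw [setDist_singleton, distW]
          convert! Real.sInf_empty
          ext x
          simp only [Set.mem_ofPred_eq, Set.mem_empty_iff_false, iff_false, not_exists]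
          exact fun p => (hb p.reachable).elim
        exact this.le
    rw [this, measure_empty]
    exact zero_le
  · have hG' : G.Preconnected := by
      have hall : ∀ b, G.Reachable a b := by
        intro b
        by_contra hb
        exact hU ⟨b, by simpa using hb⟩
      exact fun x y => (hall x).symm.trans (hall y)
    have h₂ : k₂ ≤ Fintype.card V := by
      rw [← Finset.card_univ]
      exact h _ ⟨a, Finset.mem_univ a⟩ (bdry_eq_zero_of_not_adj (by simp))
    refine (measure_slowSet_le hG' hℓ h₁₂ h₂ hc k₂ {a} (Finset.singleton_nonempty a)
      (by simp; omega) (by simp) s).trans (ENNReal.ofReal_le_ofReal ?_)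
    rw [Finset.card_singleton, max_eq_right (by omega)]
    gcongr
    refine le_trans ?_ (Finset.single_le_sum (fun b _ => add_nonneg (badProb_nonneg G _ {b})
      (badProb_nonneg G _ {b})) (Finset.mem_univ a))
    linarith [badProb_nonneg (bad := badClosed) (halt := largeBdry (k₁ ^ 2)) G k₁ {a}]

end Growth

section Bounds

set_option linter.unusedSectionVars false

variable {V : Type*} [Fintype V] {d : V → ℕ} {M σ : ℝ} {D : ℕ}

lemma one_step_of_le {K : ℕ} (hD : ∀ i, d i ≤ D)
    (hσ : ∀ X : Finset V, X.card < K → ∑ i ∈ X, (d i : ℝ) ≤ σ)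
    (hMpos : 0 < M) (hM : M ≤ (∑ i, (d i : ℝ)) - 2 * σ - 2 * D - 2 * (D : ℝ) ^ 2)
    {X : Finset V} (hX : X.card < K) {h : SimpleGraph V → ℝ} (h0 : ∀ G, 0 ≤ h G)
    (hloc : LocalOn d X h) {q : ℝ} (hq0 : 0 ≤ q)
    (hq : ∀ G ∈ degGraphs d, h G ≠ 0 → (bdry G X : ℝ) ≤ q) (θ : ℝ) :
    ∑ G ∈ degGraphs d, h G * stepAvg G X (fun Y => Real.exp (-θ * bdry G Y)) ≤
      stepFactor d M q θ * ∑ G ∈ degGraphs d, h G * Real.exp (-θ * bdry G X) := by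
  refine one_step h0 hloc hMpos (fun v G hG x _ _ => ?_) hq hq0 θ
  refine le_trans ?_ (card_switchable_ge hG hD X v x)
  linarith [hσ X hX]

lemma bdry_le_of_mem {G : SimpleGraph V} (hG : G ∈ degGraphs d) (X : Finset V) :
    (bdry G X : ℝ) ≤ ∑ i ∈ X, (d i : ℝ) := by
  have := bdry_le G X
  simp only [mem_degGraphs.1 hG] at this
  exact_mod_cast this

lemma bdry_singleton {G : SimpleGraph V} (hG : G ∈ degGraphs d) (b : V) :
    bdry G {b} = d b := by
  have := bdry_insert G (Finset.notMem_empty b)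
  have h0 : bdry G ∅ = 0 := bdry_eq_zero_of_not_adj (by simp)
  have h1 : nbrCount G ∅ b = 0 := rfl
  rw [h0, h1, mem_degGraphs.1 hG] at this
  simpa using this

lemma sum_badGrowth_le {k₁ f : ℕ} (hD : ∀ i, d i ≤ D)
    (hσ : ∀ X : Finset V, X.card < f + 1 → ∑ i ∈ X, (d i : ℝ) ≤ σ)
    (hMpos : 0 < M) (hM : M ≤ (∑ i, (d i : ℝ)) - 2 * σ - 2 * D - 2 * (D : ℝ) ^ 2)
    {θ c κ : ℝ} (hθ : 0 ≤ θ) (hκ : 0 ≤ κ)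
    (hstep : stepFactor d M σ θ ≤ Real.exp (-(θ * c + κ))) (b : V) :
    ∑ G ∈ degGraphs d, badProb (badGrowth c k₁) (fun _ _ => False) G f {b} ≤
      f * Real.exp (θ * c + κ - κ * k₁) * (degGraphs d).card := by
  have hσ0 : 0 ≤ σ := by simpa using hσ ∅ (by simp)
  set A : ℕ → ℝ := fun k => if k₁ ≤ k then Real.exp (θ * c * k) else 0 with hA
  have hA0 : ∀ k, 0 ≤ A k := fun k => by
    simp only [hA]; split_ifs
    · exact (Real.exp_pos _).le
    · exact le_rfl
  have main := sum_badProb_le (d := d) (bad := badGrowth c k₁) (halt := fun _ _ => False)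
    (θ := θ) (Real.exp_pos (-(θ * c + κ))).le hA0 (K := f + 1)
    (fun X G _ G' _ _ => rfl)
    (fun G hG X hbad => by
      simp only [hA, if_pos hbad.1]
      rw [← Real.exp_add, Real.one_le_exp_iff]
      have := hbad.2
      nlinarith)
    (fun X hX h h0 hloc _ => by
      refine (one_step_of_le hD hσ hMpos hM hX h0 hloc hσ0
        (fun G hG _ => (bdry_le_of_mem hG X).trans (hσ X hX)) θ).trans ?_
      exact mul_le_mul_of_nonneg_right hstep (Finset.sum_nonneg fun G _ =>
        mul_nonneg (h0 G) (Real.exp_pos _).le))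
    f {b} (by simp; omega) (fun _ => 1) (fun _ => zero_le_one) (fun _ _ _ _ _ => rfl)
  simp only [one_mul] at main
  refine main.trans ?_
  have h1 : ∑ j ∈ Finset.range f, Real.exp (-(θ * c + κ)) ^ j * A (Finset.card {b} + j) ≤
      f * Real.exp (θ * c + κ - κ * k₁) := by
    have := Finset.sum_le_card_nsmul (Finset.range f)
      (fun j => Real.exp (-(θ * c + κ)) ^ j * A (Finset.card {b} + j))
      (Real.exp (θ * c + κ - κ * k₁)) fun j _ => ?_
    · simpa using this
    · simp only [Finset.card_singleton, hA]
      split_ifs with hk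
      · rw [← Real.exp_nat_mul, ← Real.exp_add, Real.exp_le_exp]
        have : (k₁ : ℝ) ≤ ((1 + j : ℕ) : ℝ) := by exact_mod_cast hk
        push_cast at this ⊢
        nlinarith
      · rw [mul_zero]; exact (Real.exp_pos _).le
  have h2 : ∑ G ∈ degGraphs d, Real.exp (-θ * bdry G {b}) ≤ (degGraphs d).card := by
    have := Finset.sum_le_card_nsmul (degGraphs d) (fun G => Real.exp (-θ * bdry G {b})) 1
      fun G _ => by
        rw [Real.exp_le_one_iff]
        have : (0 : ℝ) ≤ bdry G {b} := Nat.cast_nonneg _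
        nlinarith
    simpa using this
  exact mul_le_mul h1 h2 (Finset.sum_nonneg fun _ _ => (Real.exp_pos _).le) (by positivity)

lemma stepFactor_le_of_three_le (hd : ∀ v, 3 ≤ d v) (hMpos : 0 < M) {q θ : ℝ}
    (hη : Real.exp (2 * θ) * q / M ≤ 1) (hθ : 1 ≤ θ) :
    stepFactor d M q θ ≤ (∑ i, (d i : ℝ)) / M * Real.exp (3 - θ) := by
  rw [stepFactor, Finset.sum_div, Finset.sum_mul]
  refine Finset.sum_le_sum fun v _ => mul_le_mul_of_nonneg_left ?_ (by positivity)
  rw [Real.exp_le_exp]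
  have : (3 : ℝ) ≤ d v := by exact_mod_cast hd v
  nlinarith

lemma sum_badClosed_le {k q : ℕ} (hd : ∀ v, 3 ≤ d v) (hD : ∀ i, d i ≤ D)
    (hσ : ∀ X : Finset V, X.card < k + 1 → ∑ i ∈ X, (d i : ℝ) ≤ σ)
    (hMpos : 0 < M) (hM : M ≤ (∑ i, (d i : ℝ)) - 2 * σ - 2 * D - 2 * (D : ℝ) ^ 2)
    {θ ρ : ℝ} (hθ : 1 ≤ θ) (hη : Real.exp (2 * θ) * q / M ≤ 1)
    (hρ : (∑ i, (d i : ℝ)) / M * Real.exp (3 - θ) ≤ ρ) (hρ1 : ρ ≤ 1) (b : V) :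
    ∑ G ∈ degGraphs d, badProb badClosed (largeBdry q) G k {b} ≤
      k * ρ ^ 3 * Real.exp (-(3 * θ)) * (degGraphs d).card := by
  have hρ0 : 0 ≤ ρ := le_trans (mul_nonneg (div_nonneg (Finset.sum_nonneg fun _ _ =>
    Nat.cast_nonneg _) hMpos.le) (Real.exp_pos _).le) hρ
  set A : ℕ → ℝ := fun k => if 4 ≤ k then 1 else 0 with hA
  have hA0 : ∀ k, 0 ≤ A k := fun k => by
    simp only [hA]; split_ifs <;> norm_num
  have main := sum_badProb_le (d := d) (bad := badClosed) (halt := largeBdry q)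
    (θ := θ) hρ0 hA0 (K := k + 1)
    (fun X => (localOn_bdry d X).comp fun m => q ≤ m)
    (fun G hG X hbad => by
      simp only [hA, if_pos hbad.1, hbad.2]
      simp)
    (fun X hX h h0 hloc hhalt => by
      refine (one_step_of_le hD hσ hMpos hM hX h0 hloc (Nat.cast_nonneg q)
        (fun G hG hne => ?_) θ).trans ?_
      · by_contra hlt
        exact hne (hhalt G hG (by
          have : (q : ℝ) ≤ bdry G X := (not_le.1 hlt).le
          exact_mod_cast this))
      · exact mul_le_mul_of_nonneg_right ((stepFactor_le_of_three_le hd hMpos hη hθ).trans hρ)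
          (Finset.sum_nonneg fun G _ => mul_nonneg (h0 G) (Real.exp_pos _).le))
    k {b} (by simp; omega) (fun _ => 1) (fun _ => zero_le_one) (fun _ _ _ _ _ => rfl)
  simp only [one_mul] at main
  refine main.trans ?_
  have h1 : ∑ j ∈ Finset.range k, ρ ^ j * A (Finset.card {b} + j) ≤ k * ρ ^ 3 := by
    have := Finset.sum_le_card_nsmul (Finset.range k)
      (fun j => ρ ^ j * A (Finset.card {b} + j)) (ρ ^ 3) fun j _ => ?_
    · simpa using this
    · simp only [Finset.card_singleton, hA]
      split_ifs with hk
      · rw [mul_one]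
        exact pow_le_pow_of_le_one hρ0 hρ1 (by omega)
      · rw [mul_zero]; positivity
  have h2 : ∑ G ∈ degGraphs d, Real.exp (-θ * bdry G {b}) ≤
      Real.exp (-(3 * θ)) * (degGraphs d).card := by
    have := Finset.sum_le_card_nsmul (degGraphs d) (fun G => Real.exp (-θ * bdry G {b}))
      (Real.exp (-(3 * θ))) fun G hG => by
        rw [Real.exp_le_exp, bdry_singleton hG]
        have : (3 : ℝ) ≤ d b := by exact_mod_cast hd b
        nlinarith
    rw [nsmul_eq_mul, mul_comm] at this
    exact this
  rw [mul_assoc (k * ρ ^ 3)]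
  exact mul_le_mul h1 h2 (Finset.sum_nonneg fun _ _ => (Real.exp_pos _).le) (by positivity)

/-- The vertices in a small set have small total degree. -/
lemma sum_degree_le {C : ℝ} (hC : ∑ i, (d i : ℝ) ^ 2 ≤ C) {X : Finset V} {k : ℝ}
    (hX : X.card ≤ k) : ∑ i ∈ X, (d i : ℝ) ≤ Real.sqrt (k * C) := by
  apply Real.le_sqrt_of_sq_le
  have h1 := sq_sum_le_card_mul_sum_sq (s := X) (f := fun i => (d i : ℝ))
  have h2 : ∑ i ∈ X, (d i : ℝ) ^ 2 ≤ C :=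
    (Finset.sum_le_sum_of_subset_of_nonneg (Finset.subset_univ X) fun _ _ _ => sq_nonneg _).trans hC
  have h3 : 0 ≤ ∑ i ∈ X, (d i : ℝ) ^ 2 := Finset.sum_nonneg fun _ _ => sq_nonneg _
  calc _ ≤ (X.card : ℝ) * ∑ i ∈ X, (d i : ℝ) ^ 2 := h1
    _ ≤ k * C := mul_le_mul hX h2 h3 ((Nat.cast_nonneg _).trans hX)

end Bounds

section Assembly

variable {n : ℕ}

lemma measure_event_le (d : Fin n → ℕ) {k₁ k₂ : ℝ} {s B : ℝ} (hB : 0 ≤ B)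
    {x : SimpleGraph (Fin n) → ℝ} (hx : ∀ G, 0 ≤ x G)
    (h : ∀ G ∈ degGraphs d, ∀ a, expPi (Sym2 (Fin n)) (slowSet G ⌈k₁⌉₊ ⌈k₂⌉₊ {a} s) ≤
      ENNReal.ofReal (x G))
    (hsum : ∑ G ∈ degGraphs d, x G ≤ B * (degGraphs d).card) :
    ((((uniformGraph n d).prod (weightMeasure n 1)).prod
        (uniformOn (Set.univ : Set (Fin n))))
      {ω | s ≤ hitTime ω.1.1 ω.1.2 ω.2 k₂ - hitTime ω.1.1 ω.1.2 ω.2 k₁}).toReal ≤ B := by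
  refine ENNReal.toReal_le_of_le_ofReal hB ?_
  set U := uniformGraph n d
  set W := weightMeasure n 1 with hW
  set A := uniformOn (Set.univ : Set (Fin n))
  have hWe : W = expPi (Sym2 (Fin n)) := rfl
  have : SigmaFinite W := by rw [hWe]; infer_instance
  have hA1 : A Set.univ ≤ 1 := prob_le_one
  set T : SimpleGraph (Fin n) → Fin n → Set (Sym2 (Fin n) → ℝ) :=
    fun G a => {w | s ≤ hitTime G w a k₂ - hitTime G w a k₁}
  have hT : ∀ G ∈ degGraphs d, ∀ a, W (T G a) ≤ ENNReal.ofReal (x G) := by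
    intro G hG a
    refine le_trans (measure_mono_ae ?_) (h G hG a)
    filter_upwards [expPi_nonneg] with w hw hmem
    refine ⟨hw, ?_⟩
    have : s ≤ hitTime G w a k₂ - hitTime G w a k₁ := hmem
    rwa [hitTime_eq_setHit, hitTime_eq_setHit] at this
  have hcov : {ω : (SimpleGraph (Fin n) × (Sym2 (Fin n) → ℝ)) × Fin n |
      s ≤ hitTime ω.1.1 ω.1.2 ω.2 k₂ - hitTime ω.1.1 ω.1.2 ω.2 k₁} ⊆
      ⋃ G, ⋃ a, ({G} ×ˢ T G a) ×ˢ {a} := by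
    rintro ⟨⟨G, w⟩, a⟩ hω
    simp only [Set.mem_iUnion]
    exact ⟨G, a, ⟨rfl, hω⟩, rfl⟩
  have hU : ∀ G, U {G} = if G ∈ degGraphs d then ((degGraphs d).card : ENNReal)⁻¹ else 0 := by
    intro G
    have hset : {G : SimpleGraph (Fin n) | ∀ i, G.degree i = d i} = ↑(degGraphs d) := by
      ext G
      simp [mem_degGraphs]
    change uniformOn {G : SimpleGraph (Fin n) | ∀ i, G.degree i = d i} {G} = _
    rw [hset, uniformOn, cond_apply (Finset.measurableSet _), Measure.count_apply_finset]
    split_ifs with hG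
    · have : (↑(degGraphs d) ∩ {G} : Set (SimpleGraph (Fin n))) = {G} := by
        ext G'; simp; rintro rfl; exact hG
      rw [this, Measure.count_singleton, mul_one]
    · have : (↑(degGraphs d) ∩ {G} : Set (SimpleGraph (Fin n))) = ∅ := by
        ext G'; simp; rintro h rfl; exact hG h
      rw [this, measure_empty, mul_zero]
  calc _ ≤ ∑ G, ∑ a, U {G} * W (T G a) * A {a} := by
        refine (measure_mono hcov).trans ((measure_iUnion_fintype_le _ _).trans ?_)
        refine Finset.sum_le_sum fun G _ => (measure_iUnion_fintype_le _ _).trans ?_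
        refine Finset.sum_le_sum fun a _ => ?_
        rw [Measure.prod_prod, Measure.prod_prod]
    _ ≤ ∑ G, ∑ a, U {G} * ENNReal.ofReal (x G) * A {a} := by
        refine Finset.sum_le_sum fun G _ => Finset.sum_le_sum fun a _ => ?_
        by_cases hG : G ∈ degGraphs d
        · gcongr
          exact hT G hG a
        · simp [hU, hG]
    _ = (∑ G, U {G} * ENNReal.ofReal (x G)) * A Set.univ := by
        simp_rw [← Finset.mul_sum]
        rw [Finset.sum_mul]
        congr 1
        ext G
        congr 1
        rw [← Finset.coe_univ, ← sum_measure_singleton]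
    _ ≤ (∑ G, U {G} * ENNReal.ofReal (x G)) * 1 := by gcongr
    _ = ((degGraphs d).card : ENNReal)⁻¹ * ENNReal.ofReal (∑ G ∈ degGraphs d, x G) := by
        rw [mul_one, ENNReal.ofReal_sum_of_nonneg fun G _ => hx G, Finset.mul_sum,
          ← Finset.sum_filter_add_sum_filter_not Finset.univ (· ∈ degGraphs d)]
        rw [Finset.sum_eq_zero (s := Finset.univ.filter fun G => ¬ G ∈ degGraphs d), add_zero]
        · rw [Finset.filter_mem_eq_inter, Finset.univ_inter]
          exact Finset.sum_congr rfl fun G hG => by rw [hU, if_pos hG]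
        · intro G hG
          rw [hU, if_neg (Finset.mem_filter.1 hG).2, zero_mul]
    _ ≤ ((degGraphs d).card : ENNReal)⁻¹ * (ENNReal.ofReal B * (degGraphs d).card) := by
        gcongr
        rw [← ENNReal.ofReal_natCast, ← ENNReal.ofReal_mul hB]
        exact ENNReal.ofReal_le_ofReal hsum
    _ ≤ ENNReal.ofReal B := by
        rw [mul_left_comm]
        exact mul_le_of_le_one_right' (ENNReal.inv_mul_le_one _)

end Assembly

section DegreeLimits

variable {d : ∀ n : ℕ, Fin n → ℕ} {p : ℕ → ℝ} {dmin : ℕ}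

/-- Proportion of vertices of degree `r`. -/
def degFreq (d : ∀ n : ℕ, Fin n → ℕ) (n r : ℕ) : ℝ :=
  ((Finset.univ.filter fun i : Fin n => d n i = r).card : ℝ) / n

lemma degFreq_nonneg (n r : ℕ) : 0 ≤ degFreq d n r := by unfold degFreq; positivity

lemma degFreq_le_one (n r : ℕ) : degFreq d n r ≤ 1 := by
  refine div_le_one_of_le₀ ?_ (Nat.cast_nonneg n)
  have := Finset.card_filter_le (Finset.univ : Finset (Fin n)) fun i => d n i = r
  rw [Finset.card_fin] at this
  exact_mod_cast this

lemma hasSum_mul_degFreq (F : ℕ → ℝ) (n : ℕ) :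
    HasSum (fun r => F r * degFreq d n r) ((∑ i, F (d n i)) / n) := by
  have h : (∑ i, F (d n i)) / n = ∑ r ∈ Finset.univ.image (d n), F r * degFreq d n r := by
    rw [Finset.sum_comp F (d n), Finset.sum_div]
    refine Finset.sum_congr rfl fun r _ => ?_
    rw [nsmul_eq_mul, degFreq, mul_comm, mul_div_assoc]
  rw [h]
  refine hasSum_sum_of_ne_finset_zero fun r hr => ?_
  have : (Finset.univ.filter fun i : Fin n => d n i = r) = ∅ := by
    ext i
    simp only [Finset.mem_image, Finset.mem_univ, true_and, not_exists] at hr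
    simp [hr i]
  simp [degFreq, this]

lemma DegreeCondition.tendsto_degFreq (hcond : DegreeCondition d p dmin) (r : ℕ) :
    Tendsto (fun n => degFreq d n r) atTop (nhds (p r)) :=
  hcond.tendsto_freq r

lemma DegreeCondition.three_le (hcond : DegreeCondition d p dmin) {n : ℕ} (i : Fin n) :
    3 ≤ d n i := by
  have h := hcond.min_eq n i.pos
  have h' : sInf (Set.range (d n)) ≤ d n i := Nat.sInf_le (Set.mem_range_self i)
  exact hcond.min_ge.trans (h ▸ h')

lemma DegreeCondition.eq_zero_of_lt (hcond : DegreeCondition d p dmin) {r : ℕ} (hr : r < 3) :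
    p r = 0 := by
  refine tendsto_nhds_unique (hcond.tendsto_degFreq r) ?_
  have : (fun n => degFreq d n r) = fun _ => 0 := by
    ext n
    have : (Finset.univ.filter fun i : Fin n => d n i = r) = ∅ := by
      ext i
      have := hcond.three_le i
      simp only [Finset.mem_filter, Finset.mem_univ, true_and, Finset.notMem_empty, iff_false]
      omega
    simp [degFreq, this]
  rw [this]
  exact tendsto_const_nhds

lemma DegreeCondition.tendsto_sum_range (hcond : DegreeCondition d p dmin) (F : ℕ → ℝ) (R : ℕ) :
    Tendsto (fun n => ∑ r ∈ Finset.range R, F r * degFreq d n r) atTop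
      (nhds (∑ r ∈ Finset.range R, F r * p r)) :=
  tendsto_finsetSum _ fun r _ => (hcond.tendsto_degFreq r).const_mul _

lemma sum_range_mul_degFreq_le {F : ℕ → ℝ} (hF : ∀ r, 0 ≤ F r) (n R : ℕ) :
    ∑ r ∈ Finset.range R, F r * degFreq d n r ≤ (∑ i, F (d n i)) / n :=
  sum_le_hasSum _ (fun r _ => mul_nonneg (hF r) (degFreq_nonneg n r)) (hasSum_mul_degFreq F n)

lemma DegreeCondition.summable_sq_mul (hcond : DegreeCondition d p dmin) :
    Summable fun r : ℕ => (r : ℝ) ^ 2 * p r := by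
  obtain ⟨C, hC⟩ := hcond.sq_bound
  refine summable_of_sum_range_le (c := C) (fun r => mul_nonneg (sq_nonneg _) (hcond.nonneg r))
    fun R => ?_
  refine le_of_tendsto (hcond.tendsto_sum_range (fun r => (r : ℝ) ^ 2) R) ?_
  filter_upwards [eventually_gt_atTop 0] with n hn
  refine (sum_range_mul_degFreq_le (fun r => sq_nonneg _) n R).trans ?_
  rw [div_le_iff₀ (by exact_mod_cast hn)]
  exact hC n

lemma DegreeCondition.tsum_sq_mul (hcond : DegreeCondition d p dmin) :
    ∑' r : ℕ, (r : ℝ) ^ 2 * p r = lambdaOf p * (nuOf p + 1) := by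
  have hpos : 0 < lambdaOf p := hcond.lambda_pos
  have h1 : Summable fun r : ℕ => (r : ℝ) ^ 2 * p r - r * p r :=
    hcond.summable_sq_mul.sub hcond.summable_mul
  have h2 := h1.tsum_eq_zero_add
  rw [hcond.summable_sq_mul.tsum_sub hcond.summable_mul] at h2
  have h3 : ∑' r : ℕ, (((r + 1 : ℕ) : ℝ) ^ 2 * p (r + 1) - ((r + 1 : ℕ) : ℝ) * p (r + 1)) =
      ∑' r : ℕ, (r : ℝ) * (((r : ℝ) + 1) * p (r + 1)) :=
    tsum_congr fun r => by push_cast; ring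
  rw [h3] at h2
  have h4 : lambdaOf p * nuOf p = ∑' r : ℕ, (r : ℝ) * (((r : ℝ) + 1) * p (r + 1)) := by
    rw [nuOf]; field_simp
  rw [mul_add, h4, mul_one, lambdaOf]
  simp at h2
  linarith

lemma DegreeCondition.two_le_nuOf (hcond : DegreeCondition d p dmin) : 2 ≤ nuOf p := by
  have hpos : 0 < lambdaOf p := hcond.lambda_pos
  have h : ∑' r : ℕ, 3 * ((r : ℝ) * p r) ≤ ∑' r : ℕ, (r : ℝ) ^ 2 * p r := by
    refine (hcond.summable_mul.mul_left 3).tsum_le_tsum (fun r => ?_) hcond.summable_sq_mul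
    rcases lt_or_ge r 3 with hr | hr
    · simp [hcond.eq_zero_of_lt hr]
    · have hr' : (3 : ℝ) ≤ r := by exact_mod_cast hr
      have := mul_nonneg (mul_nonneg (Nat.cast_nonneg (α := ℝ) r) (sub_nonneg.2 hr'))
        (hcond.nonneg r)
      linarith
  rw [tsum_mul_left, hcond.tsum_sq_mul] at h
  change 3 * lambdaOf p ≤ _ at h
  nlinarith

lemma DegreeCondition.eventually_mul_le_sum (hcond : DegreeCondition d p dmin) {l : ℝ}
    (hl : l < lambdaOf p) : ∀ᶠ n : ℕ in atTop, l * n ≤ ∑ i, (d n i : ℝ) := by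
  obtain ⟨R, hR⟩ := ((hcond.summable_mul.hasSum.tendsto_sum_nat).eventually_const_lt hl).exists
  filter_upwards [(hcond.tendsto_sum_range (fun r => (r : ℝ)) R).eventually_const_lt hR,
    eventually_gt_atTop 0] with n hn hn0
  have := hn.le.trans (sum_range_mul_degFreq_le (fun r => Nat.cast_nonneg r) n R)
  rwa [le_div_iff₀ (by exact_mod_cast hn0)] at this

lemma summable_mul_exp_neg {θ : ℝ} (hθ : 0 < θ) :
    Summable fun r : ℕ => (r : ℝ) * Real.exp (-(θ * r)) := by
  have := Real.summable_pow_mul_exp_neg_nat_mul 1 hθ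
  simpa using this

lemma DegreeCondition.tendsto_sum_mul_exp_neg (hcond : DegreeCondition d p dmin) {θ : ℝ}
    (hθ : 0 < θ) :
    Tendsto (fun n : ℕ => (∑ i, (d n i : ℝ) * Real.exp (-(θ * d n i))) / n) atTop
      (nhds (∑' r : ℕ, (r : ℝ) * Real.exp (-(θ * r)) * p r)) := by
  have h := tendsto_tsum_of_dominated_convergence (𝓕 := atTop)
    (f := fun n (r : ℕ) => (r : ℝ) * Real.exp (-(θ * r)) * degFreq d n r)
    (g := fun r : ℕ => (r : ℝ) * Real.exp (-(θ * r)) * p r)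
    (summable_mul_exp_neg hθ) (fun r => (hcond.tendsto_degFreq r).const_mul _)
    (Eventually.of_forall fun n r => by
      rw [Real.norm_of_nonneg (mul_nonneg (by positivity) (degFreq_nonneg n r))]
      exact mul_le_of_le_one_right (by positivity) (degFreq_le_one n r))
  refine h.congr fun n => ?_
  exact (hasSum_mul_degFreq (fun r : ℕ => (r : ℝ) * Real.exp (-(θ * r))) n).tsum_eq

lemma exp_neg_le_quadratic {x : ℝ} (hx : 0 ≤ x) : Real.exp (-x) ≤ 1 - x + x ^ 2 := by
  rw [Real.exp_neg]
  refine (inv_anti₀ (by linarith) (Real.add_one_le_exp x)).trans ?_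
  rw [inv_le_iff_one_le_mul₀ (by linarith)]
  nlinarith [pow_nonneg hx 3]

/-- A Laplace parameter for which the boundary grows at least at rate `c < ν - 1`. -/
lemma DegreeCondition.exists_laplace (hcond : DegreeCondition d p dmin) {c : ℝ} (hc0 : 0 < c)
    (hc : c < nuOf p - 1) :
    ∃ θ' θ : ℝ, 0 < θ' ∧ θ' < θ ∧
      Real.exp (2 * θ + θ * c) * (∑' r : ℕ, (r : ℝ) * Real.exp (-(θ' * r)) * p r) <
        lambdaOf p := by
  have hpos : 0 < lambdaOf p := hcond.lambda_pos
  obtain ⟨m, hm1, hm2⟩ := exists_between (show c + 2 < nuOf p + 1 by linarith)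
  have hlim := hcond.summable_sq_mul.hasSum.tendsto_sum_nat
  rw [hcond.tsum_sq_mul] at hlim
  obtain ⟨R, hR⟩ := (hlim.eventually_const_lt
    (show lambdaOf p * m < lambdaOf p * (nuOf p + 1) by gcongr)).exists
  set A := ∑ r ∈ Finset.range R, (r : ℝ) ^ 2 * p r
  set B := ∑ r ∈ Finset.range R, (r : ℝ) ^ 3 * p r
  have hB : 0 ≤ B := Finset.sum_nonneg fun r _ => mul_nonneg (by positivity) (hcond.nonneg r)
  set t := (A - lambdaOf p * m) / (2 * (B + 1)) with ht
  have ht0 : 0 < t := div_pos (by linarith) (by linarith)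
  have htB : t * B < A - lambdaOf p * m := by
    have : t * (2 * (B + 1)) = A - lambdaOf p * m := by rw [ht]; field_simp
    nlinarith
  have hsumm : Summable fun r : ℕ => (r : ℝ) * Real.exp (-(t * r)) * p r := by
    refine hcond.summable_mul.of_nonneg_of_le
      (fun r => mul_nonneg (by positivity) (hcond.nonneg r)) fun r => ?_
    refine mul_le_mul_of_nonneg_right ?_ (hcond.nonneg r)
    exact mul_le_of_le_one_right (Nat.cast_nonneg r)
      (Real.exp_le_one_iff.2 (by have := mul_nonneg ht0.le (Nat.cast_nonneg (α := ℝ) r); linarith))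
  set S := ∑' r : ℕ, (r : ℝ) * Real.exp (-(t * r)) * p r with hS
  have hgap : t * (A - t * B) ≤ lambdaOf p - S := by
    rw [lambdaOf, hS, ← hcond.summable_mul.tsum_sub hsumm]
    have hterm : ∀ r : ℕ, 0 ≤ (r : ℝ) * p r - r * Real.exp (-(t * r)) * p r := fun r => by
      have h1 : Real.exp (-(t * r)) ≤ 1 :=
        Real.exp_le_one_iff.2 (by
          have := mul_nonneg ht0.le (Nat.cast_nonneg (α := ℝ) r); linarith)
      have := mul_nonneg (mul_nonneg (Nat.cast_nonneg (α := ℝ) r) (sub_nonneg.2 h1))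
        (hcond.nonneg r)
      linarith
    refine le_trans ?_ ((hcond.summable_mul.sub hsumm).sum_le_tsum (Finset.range R)
      fun r _ => hterm r)
    simp only [A, B, mul_sub, Finset.mul_sum, ← Finset.sum_sub_distrib]
    refine Finset.sum_le_sum fun r _ => ?_
    have h1 := exp_neg_le_quadratic (mul_nonneg ht0.le (Nat.cast_nonneg (α := ℝ) r))
    have := mul_nonneg (mul_nonneg (Nat.cast_nonneg (α := ℝ) r) (sub_nonneg.2 h1))
      (hcond.nonneg r)
    nlinarith
  have hSlt : S < lambdaOf p * (1 - m * t) := by nlinarith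
  refine ⟨t, m * t / (c + 2), ht0, ?_, ?_⟩
  · rw [lt_div_iff₀ (by linarith)]
    nlinarith
  · have : 2 * (m * t / (c + 2)) + m * t / (c + 2) * c = m * t := by field_simp; ring
    rw [this]
    have h1 : 1 - m * t ≤ Real.exp (-(m * t)) := Real.one_sub_le_exp_neg _
    calc Real.exp (m * t) * S < Real.exp (m * t) * (lambdaOf p * Real.exp (-(m * t))) := by
          gcongr
          exact hSlt.trans_le (by gcongr)
      _ = lambdaOf p := by
          rw [mul_left_comm, ← Real.exp_add]; simp

end DegreeLimits

section LogAsymptotics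

lemma tendsto_log_natCast : Tendsto (fun n : ℕ => Real.log n) atTop atTop :=
  Real.tendsto_log_atTop.comp tendsto_natCast_atTop_atTop

lemma eventually_mul_log_pow_le (C : ℝ) (k : ℕ) {δ : ℝ} (hδ : 0 < δ) :
    ∀ᶠ n : ℕ in atTop, C * Real.log n ^ k ≤ Real.exp (δ * Real.log n) := by
  have h : Tendsto (fun x : ℝ => C * (x ^ k * Real.exp (-δ * x))) atTop (nhds (C * 0)) :=
    ((tendsto_rpow_mul_exp_neg_mul_atTop_nhds_zero k δ hδ).congr fun x => by
      rw [Real.rpow_natCast]).const_mul C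
  rw [mul_zero] at h
  filter_upwards [tendsto_log_natCast.eventually (h.eventually_le_const zero_lt_one)] with n hn
  rwa [neg_mul, Real.exp_neg, ← mul_assoc, ← div_eq_mul_inv, div_le_one (Real.exp_pos _)] at hn

lemma eventually_le_exp_log (C : ℝ) {δ : ℝ} (hδ : 0 < δ) :
    ∀ᶠ n : ℕ in atTop, C ≤ Real.exp (δ * Real.log n) := by
  simpa using eventually_mul_log_pow_le C 0 hδ

lemma natCast_eq_exp_log {n : ℕ} (hn : 0 < n) : (n : ℝ) = Real.exp (Real.log n) :=
  (Real.exp_log (by exact_mod_cast hn)).symm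

lemma eventually_ceil_alphaSeq_le {δ : ℝ} (hδ : 0 < δ) :
    ∀ᶠ n : ℕ in atTop, (⌈alphaSeq n⌉₊ : ℝ) ≤ Real.exp (δ * Real.log n) := by
  filter_upwards [eventually_mul_log_pow_le 2 3 hδ,
    tendsto_log_natCast.eventually_ge_atTop 1] with n h1 h2
  have h3 : 1 ≤ alphaSeq n := one_le_pow₀ h2
  have h4 := (Nat.ceil_lt_add_one (zero_le_one.trans h3)).le
  have h5 : alphaSeq n = Real.log n ^ 3 := rfl
  linarith

lemma eventually_ceil_betaSeq_le (p : ℕ → ℝ) (hK : 0 ≤ lambdaOf p / (nuOf p - 1)) :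
    ∀ᶠ n : ℕ in atTop,
      (⌈betaSeq p n⌉₊ : ℝ) ≤ Real.exp (Real.log n / 2) * Real.log n := by
  set K := lambdaOf p / (nuOf p - 1) with hKdef
  filter_upwards [tendsto_log_natCast.eventually_ge_atTop (36 * K),
    tendsto_log_natCast.eventually_ge_atTop 2, eventually_gt_atTop 0] with n h1 h2 hn
  have hβ : betaSeq p n ≤ Real.exp (Real.log n / 2) * Real.log n / 2 := by
    have : Real.sqrt (K * n * Real.log n) ≤ Real.exp (Real.log n / 2) * Real.log n / 6 := by
      refine Real.sqrt_le_iff.2 ⟨by positivity, ?_⟩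
      have h3 : Real.exp (Real.log n / 2) ^ 2 = n := by
        rw [← Real.exp_nat_mul]
        push_cast
        rw [mul_div_cancel₀ _ two_ne_zero, Real.exp_log (by exact_mod_cast hn)]
      rw [div_pow, mul_pow, h3]
      have h4 : 0 ≤ (n : ℝ) * Real.log n := by positivity
      nlinarith
    rw [betaSeq]
    linarith
  have hβ0 : 0 ≤ betaSeq p n := by unfold betaSeq; positivity
  have h4 := (Nat.ceil_lt_add_one hβ0).le
  have h5 : 1 ≤ Real.exp (Real.log n / 2) := Real.one_le_exp (by linarith)
  nlinarith

lemma eventually_ceil_betaSeq_le_exp (p : ℕ → ℝ) (hK : 0 ≤ lambdaOf p / (nuOf p - 1)) {δ : ℝ}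
    (hδ : 1 / 2 < δ) :
    ∀ᶠ n : ℕ in atTop, (⌈betaSeq p n⌉₊ : ℝ) ≤ Real.exp (δ * Real.log n) := by
  filter_upwards [eventually_ceil_betaSeq_le p hK,
    eventually_mul_log_pow_le 1 1 (sub_pos.2 hδ)] with n h1 h2
  refine h1.trans ?_
  rw [one_mul, pow_one] at h2
  calc _ ≤ Real.exp (Real.log n / 2) * Real.exp ((δ - 1 / 2) * Real.log n) := by gcongr
    _ = _ := by rw [← Real.exp_add]; ring_nf

lemma eventually_alphaSeq_le_betaSeq (p : ℕ → ℝ) (hK : 0 < lambdaOf p / (nuOf p - 1)) :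
    ∀ᶠ n : ℕ in atTop, alphaSeq n ≤ betaSeq p n := by
  set K := lambdaOf p / (nuOf p - 1) with hKdef
  filter_upwards [eventually_mul_log_pow_le K⁻¹ 5 zero_lt_one,
    tendsto_log_natCast.eventually_ge_atTop 1, eventually_gt_atTop 0] with n h1 h2 hn
  rw [one_mul, ← natCast_eq_exp_log hn, inv_mul_le_iff₀ hK] at h1
  have h3 : alphaSeq n ≤ Real.sqrt (K * n * Real.log n) := by
    apply Real.le_sqrt_of_sq_le
    calc (Real.log n ^ 3) ^ 2 = Real.log n ^ 5 * Real.log n := by ring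
      _ ≤ K * n * Real.log n := by gcongr
  have h4 := Real.sqrt_nonneg (K * n * Real.log n)
  rw [betaSeq]
  linarith

lemma eventually_degree_bound {d : ∀ n : ℕ, Fin n → ℕ} {p : ℕ → ℝ} {dmin : ℕ}
    (hcond : DegreeCondition d p dmin) {δ : ℝ} (hδ : 0 < δ) :
    ∀ᶠ n : ℕ in atTop, 2 * ((Finset.univ.sup (d n) : ℕ) : ℝ) +
      2 * ((Finset.univ.sup (d n) : ℕ) : ℝ) ^ 2 ≤ δ * n := by
  obtain ⟨τ, hτ, C, hC⟩ := hcond.max_bound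
  filter_upwards [eventually_le_exp_log (4 * C ^ 2 / δ) (show 0 < 2 * τ by linarith),
    eventually_gt_atTop 0] with n h1 hn
  set D := Finset.univ.sup (d n)
  have h2 : (D : ℝ) ≤ (D : ℝ) ^ 2 := by exact_mod_cast Nat.le_self_pow two_ne_zero D
  have h3 : (D : ℝ) ^ 2 ≤ C ^ 2 * Real.exp ((1 - 2 * τ) * Real.log n) := by
    have h4 := pow_le_pow_left₀ (Nat.cast_nonneg D) (hC n) 2
    rw [Real.rpow_def_of_pos (by exact_mod_cast hn), mul_pow, ← Real.exp_nat_mul] at h4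
    refine h4.trans_eq ?_
    congr 2
    push_cast
    ring
  rw [div_le_iff₀ hδ] at h1
  calc _ ≤ 4 * C ^ 2 * Real.exp ((1 - 2 * τ) * Real.log n) := by linarith
    _ ≤ Real.exp (2 * τ * Real.log n) * δ * Real.exp ((1 - 2 * τ) * Real.log n) := by gcongr
    _ = δ * Real.exp (2 * τ * Real.log n + (1 - 2 * τ) * Real.log n) := by
        rw [Real.exp_add]; ring
    _ = δ * n := by
        rw [natCast_eq_exp_log hn, Real.log_exp]; ring_nf

lemma eventually_sqrt_le (p : ℕ → ℝ) (hK : 0 ≤ lambdaOf p / (nuOf p - 1)) {C : ℝ}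
    (hC : 0 ≤ C) {δ : ℝ} (hδ : 0 < δ) :
    ∀ᶠ n : ℕ in atTop, Real.sqrt ((⌈betaSeq p n⌉₊ + 1 : ℝ) * (C * n)) ≤ δ * n := by
  filter_upwards [eventually_ceil_betaSeq_le_exp p hK (show (1 : ℝ) / 2 < 3 / 4 by norm_num),
    eventually_le_exp_log (2 * C / δ ^ 2) (show (0 : ℝ) < 1 / 4 by norm_num),
    tendsto_log_natCast.eventually_ge_atTop 0,
    eventually_gt_atTop 0] with n h1 h2 h3 hn
  refine Real.sqrt_le_iff.2 ⟨by positivity, ?_⟩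
  rw [div_le_iff₀ (by positivity)] at h2
  have h4 : 1 ≤ Real.exp (3 / 4 * Real.log n) := Real.one_le_exp (by positivity)
  calc ((⌈betaSeq p n⌉₊ + 1 : ℝ) * (C * n)) ≤ (2 * Real.exp (3 / 4 * Real.log n)) * (C * n) := by
        gcongr; linarith
    _ = (2 * C) * Real.exp (3 / 4 * Real.log n) * n := by ring
    _ ≤ Real.exp (1 / 4 * Real.log n) * δ ^ 2 * Real.exp (3 / 4 * Real.log n) * n := by gcongr
    _ = δ ^ 2 * Real.exp (1 / 4 * Real.log n + 3 / 4 * Real.log n) * n := by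
        rw [Real.exp_add]; ring
    _ = (δ * n) ^ 2 := by
        rw [← add_mul, show (1 / 4 + 3 / 4 : ℝ) = 1 by norm_num, one_mul, ← natCast_eq_exp_log hn]
        ring

end LogAsymptotics

section Conclusion

variable {n : ℕ} {d : Fin n → ℕ}

/-- Non-asymptotic form of the estimate. -/
lemma measure_event_le_explicit (hd : ∀ v, 3 ≤ d v) {α β C s c θ κ θ₂ M : ℝ} {ℓ : ℕ}
    (hC : ∑ i, (d i : ℝ) ^ 2 ≤ C * n) (hℓ : ℓ < ⌈α⌉₊) (hαβ : α ≤ β)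
    (hc : 0 < c) (hs : 0 < s) (hM0 : 0 < M)
    (hM : M ≤ (∑ i, (d i : ℝ)) - 2 * Real.sqrt ((⌈β⌉₊ + 1 : ℝ) * (C * n)) -
      2 * (Finset.univ.sup d : ℕ) - 2 * ((Finset.univ.sup d : ℕ) : ℝ) ^ 2)
    (hθ : 0 ≤ θ) (hκ : 0 ≤ κ)
    (hstep : stepFactor d M (Real.sqrt ((⌈β⌉₊ + 1 : ℝ) * (C * n))) θ ≤ Real.exp (-(θ * c + κ)))
    (hθ₂ : 1 ≤ θ₂) (hη : Real.exp (2 * θ₂) * (⌈α⌉₊ : ℝ) ^ 2 / M ≤ 1)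
    {ρ : ℝ} (hρ : C * n / M * Real.exp (3 - θ₂) ≤ ρ) (hρ1 : ρ ≤ 1) :
    ((((uniformGraph n d).prod (weightMeasure n 1)).prod
        (uniformOn (Set.univ : Set (Fin n))))
      {ω | s ≤ hitTime ω.1.1 ω.1.2 ω.2 β - hitTime ω.1.1 ω.1.2 ω.2 α}).toReal ≤
    (((⌈β⌉₊ : ℝ) - ℓ) / ((⌈α⌉₊ : ℝ) - ℓ)) ^ ℓ * Real.exp (-(c * ℓ * s)) +
      n * (⌈β⌉₊ * Real.exp (θ * c + κ - κ * ⌈α⌉₊) +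
        ⌈α⌉₊ * ρ ^ 3 * Real.exp (-(3 * θ₂))) := by
  have h₁₂ : ⌈α⌉₊ ≤ ⌈β⌉₊ := Nat.ceil_mono hαβ
  have hσ : ∀ X : Finset (Fin n), X.card < ⌈β⌉₊ + 1 →
      ∑ i ∈ X, (d i : ℝ) ≤ Real.sqrt ((⌈β⌉₊ + 1 : ℝ) * (C * n)) := fun X hX =>
    sum_degree_le hC (by exact_mod_cast hX.le)
  have hD : ∀ i, d i ≤ Finset.univ.sup d := fun i => Finset.le_sup (Finset.mem_univ i)
  have hsum : ∑ i, (d i : ℝ) ≤ C * n := by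
    refine le_trans (Finset.sum_le_sum fun i _ => ?_) hC
    exact_mod_cast Nat.le_self_pow two_ne_zero (d i)
  have hρ' : (∑ i, (d i : ℝ)) / M * Real.exp (3 - θ₂) ≤ ρ := le_trans (by gcongr) hρ
  have hρ0 : 0 ≤ ρ := le_trans (by positivity) hρ'
  have hℓ₁ : (0 : ℝ) < (⌈α⌉₊ : ℝ) - ℓ := sub_pos.2 (by exact_mod_cast hℓ)
  have hℓ₂ : (0 : ℝ) < (⌈β⌉₊ : ℝ) - ℓ := sub_pos.2 (by exact_mod_cast hℓ.trans_le h₁₂)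
  have hmain : 0 ≤ (((⌈β⌉₊ : ℝ) - ℓ) / ((⌈α⌉₊ : ℝ) - ℓ)) ^ ℓ * Real.exp (-(c * ℓ * s)) := by
    positivity
  refine measure_event_le d (by positivity)
    (x := fun G => (((⌈β⌉₊ : ℝ) - ℓ) / ((⌈α⌉₊ : ℝ) - ℓ)) ^ ℓ * Real.exp (-(c * ℓ * s)) +
      ∑ b : Fin n, (badProb (badGrowth c ⌈α⌉₊) (fun _ _ => False) G ⌈β⌉₊ {b} +
        badProb badClosed (largeBdry (⌈α⌉₊ ^ 2)) G ⌈α⌉₊ {b}))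
    (fun G => add_nonneg hmain (Finset.sum_nonneg fun b _ =>
      add_nonneg (badProb_nonneg _ _ _) (badProb_nonneg _ _ _)))
    (fun G hG a => measure_slowSet_singleton_le hG hd hℓ h₁₂ hc hs a) ?_
  rw [Finset.sum_add_distrib, Finset.sum_const, nsmul_eq_mul, Finset.sum_comm, add_mul,
    mul_comm (Finset.card _ : ℝ)]
  refine add_le_add le_rfl ?_
  have hb : ∀ b : Fin n, ∑ G ∈ degGraphs d,
      (badProb (badGrowth c ⌈α⌉₊) (fun _ _ => False) G ⌈β⌉₊ {b} +
        badProb badClosed (largeBdry (⌈α⌉₊ ^ 2)) G ⌈α⌉₊ {b}) ≤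
      (⌈β⌉₊ * Real.exp (θ * c + κ - κ * ⌈α⌉₊) +
        ⌈α⌉₊ * ρ ^ 3 * Real.exp (-(3 * θ₂))) * (degGraphs d).card := fun b => by
    rw [Finset.sum_add_distrib, add_mul]
    exact add_le_add (sum_badGrowth_le hD hσ hM0 hM hθ hκ hstep b)
      (sum_badClosed_le hd hD (fun X hX => hσ X (by omega)) hM0 hM hθ₂
        (by push_cast; exact hη) hρ' hρ1 b)
  refine (Finset.sum_le_card_nsmul _ _ _ fun b _ => hb b).trans_eq ?_
  rw [Finset.card_fin, nsmul_eq_mul]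
  exact (mul_assoc _ _ _).symm

lemma stepFactor_le_sum {M σ θ θ' : ℝ} (hM : 0 < M) (hη : Real.exp (2 * θ) * σ / M ≤ θ - θ') :
    stepFactor d M σ θ ≤
      Real.exp (2 * θ) / M * ∑ i, (d i : ℝ) * Real.exp (-(θ' * d i)) := by
  rw [stepFactor, Finset.mul_sum]
  refine Finset.sum_le_sum fun v _ => ?_
  calc (d v : ℝ) / M * Real.exp (2 * θ - (θ - Real.exp (2 * θ) * σ / M) * d v)
      ≤ d v / M * Real.exp (2 * θ + -(θ' * d v)) := by
        gcongr
        have := mul_le_mul_of_nonneg_right hη (Nat.cast_nonneg (α := ℝ) (d v))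
        linarith
    _ = _ := by rw [Real.exp_add]; ring

/-- The contribution of first-passage percolation with the typical boundary growth. -/
lemma eventually_main_term_le (p : ℕ → ℝ) (hK : 0 < lambdaOf p / (nuOf p - 1)) {ℓ : ℕ}
    {a : ℝ} (ha : 2 + ℓ / 2 ≤ ℓ * a) :
    ∀ᶠ n : ℕ in atTop, (((⌈betaSeq p n⌉₊ : ℝ) - ℓ) / ((⌈alphaSeq n⌉₊ : ℝ) - ℓ)) ^ ℓ *
      Real.exp (-(ℓ * a * Real.log n)) ≤ Real.exp (-2 * Real.log n) := by
  filter_upwards [eventually_ceil_betaSeq_le p hK.le,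
    tendsto_log_natCast.eventually_ge_atTop (ℓ + 2), eventually_alphaSeq_le_betaSeq p hK]
    with n h1 h2 h3
  have hℓ : (0 : ℝ) ≤ ℓ := Nat.cast_nonneg ℓ
  have hL : Real.log n ≤ (⌈alphaSeq n⌉₊ : ℝ) - ℓ := by
    have h4 : alphaSeq n ≤ ⌈alphaSeq n⌉₊ := Nat.le_ceil _
    have h5 : alphaSeq n = Real.log n ^ 3 := rfl
    have h6 : Real.log n ^ 2 ≤ Real.log n ^ 3 := pow_le_pow_right₀ (by linarith) (by norm_num)
    nlinarith
  have hL0 : 0 < Real.log n := by linarith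
  have hk : (⌈alphaSeq n⌉₊ : ℝ) ≤ ⌈betaSeq p n⌉₊ := by exact_mod_cast Nat.ceil_mono h3
  have hratio : ((⌈betaSeq p n⌉₊ : ℝ) - ℓ) / ((⌈alphaSeq n⌉₊ : ℝ) - ℓ) ≤
      Real.exp (Real.log n / 2) := by
    rw [div_le_iff₀ (hL0.trans_le hL)]
    calc _ ≤ Real.exp (Real.log n / 2) * Real.log n := by linarith
      _ ≤ _ := by gcongr
  have hratio0 : 0 ≤ ((⌈betaSeq p n⌉₊ : ℝ) - ℓ) / ((⌈alphaSeq n⌉₊ : ℝ) - ℓ) :=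
    div_nonneg (by linarith) (by linarith)
  calc _ ≤ Real.exp (Real.log n / 2) ^ ℓ * Real.exp (-(ℓ * a * Real.log n)) := by gcongr
    _ = Real.exp (ℓ * (Real.log n / 2) - ℓ * a * Real.log n) := by
        rw [← Real.exp_nat_mul, ← Real.exp_add, sub_eq_add_neg]
    _ ≤ _ := by
        rw [Real.exp_le_exp]
        nlinarith

lemma eventually_growth_term_le (p : ℕ → ℝ) (hK : 0 < lambdaOf p / (nuOf p - 1)) {κ : ℝ}
    (hκ : 0 < κ) (b : ℝ) :
    ∀ᶠ n : ℕ in atTop, n * (⌈betaSeq p n⌉₊ * Real.exp (b - κ * ⌈alphaSeq n⌉₊)) ≤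
      Real.exp (-2 * Real.log n) := by
  filter_upwards [eventually_ceil_betaSeq_le_exp p hK.le (show (1 : ℝ) / 2 < 1 by norm_num),
    tendsto_log_natCast.eventually_ge_atTop ((4 + |b|) / κ),
    tendsto_log_natCast.eventually_ge_atTop 1, eventually_gt_atTop 0] with n h1 h2 h3 hn
  have h4 : κ * Real.log n ^ 3 ≤ κ * ⌈alphaSeq n⌉₊ :=
    mul_le_mul_of_nonneg_left (Nat.le_ceil (alphaSeq n)) hκ.le
  have h5 : (4 + |b|) * Real.log n ≤ κ * Real.log n ^ 3 := by
    rw [div_le_iff₀ hκ] at h2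
    have h6 : Real.log n ^ 2 ≤ Real.log n ^ 3 := pow_le_pow_right₀ h3 (by norm_num)
    nlinarith
  have h7 : b ≤ |b| * Real.log n :=
    (le_abs_self b).trans (le_mul_of_one_le_right (abs_nonneg b) h3)
  calc n * (⌈betaSeq p n⌉₊ * Real.exp (b - κ * ⌈alphaSeq n⌉₊))
      ≤ Real.exp (Real.log n) * (Real.exp (1 * Real.log n) * Real.exp (-4 * Real.log n)) := by
        rw [← natCast_eq_exp_log hn]
        gcongr
        linarith
    _ = _ := by rw [← Real.exp_add, ← Real.exp_add]; ring_nf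

lemma eventually_closed_term_le (K : ℝ) (hK : 0 ≤ K) :
    ∀ᶠ n : ℕ in atTop, n * (⌈alphaSeq n⌉₊ * (K * Real.exp (3 - 2 / 5 * Real.log n)) ^ 3 *
      Real.exp (-(3 * (2 / 5 * Real.log n)))) ≤
        K ^ 3 * Real.exp 9 * Real.exp (-(6 / 5) * Real.log n) := by
  filter_upwards [eventually_ceil_alphaSeq_le (show (0 : ℝ) < 1 / 5 by norm_num),
    eventually_gt_atTop 0] with n h1 hn
  calc n * (⌈alphaSeq n⌉₊ * (K * Real.exp (3 - 2 / 5 * Real.log n)) ^ 3 *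
      Real.exp (-(3 * (2 / 5 * Real.log n))))
      ≤ Real.exp (Real.log n) * (Real.exp (1 / 5 * Real.log n) *
        (K * Real.exp (3 - 2 / 5 * Real.log n)) ^ 3 *
          Real.exp (-(3 * (2 / 5 * Real.log n)))) := by
        rw [← natCast_eq_exp_log hn]
        gcongr
    _ = K ^ 3 * (Real.exp (Real.log n) * Real.exp (1 / 5 * Real.log n) *
        Real.exp (3 * (3 - 2 / 5 * Real.log n)) * Real.exp (-(3 * (2 / 5 * Real.log n)))) := by
        rw [mul_pow, ← Real.exp_nat_mul]
        push_cast
        ring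
    _ = _ := by
        rw [← Real.exp_add, ← Real.exp_add, ← Real.exp_add, mul_assoc, ← Real.exp_add]
        ring_nf

lemma tendsto_exp_mul_log {a : ℝ} (ha : a < 0) :
    Tendsto (fun n : ℕ => Real.exp (a * Real.log n)) atTop (nhds 0) :=
  Real.tendsto_exp_atBot.comp (tendsto_log_natCast.const_mul_atTop_of_neg ha)

end Conclusion

/-- Lemma 10 of the paper: for a uniformly chosen vertex `a` and any `ε > 0`,
`P(T_a(β_n) − T_a(α_n) ≥ (1+ε) log n/(2(ν−1))) = o(n⁻¹)`. -/
theorem hitTime_beta_minus_alpha_tail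
    (d : ∀ n : ℕ, Fin n → ℕ) (p : ℕ → ℝ) (dmin : ℕ)
    (hcond : DegreeCondition d p dmin) (ε : ℝ) (hε : 0 < ε) :
    Tendsto (fun n : ℕ => (n : ℝ) *
        ((((uniformGraph n (d n)).prod (weightMeasure n 1)).prod
              (uniformOn (Set.univ : Set (Fin n))))
            {ω | (1 + ε) * Real.log n / (2 * (nuOf p - 1)) ≤
                hitTime ω.1.1 ω.1.2 ω.2 (betaSeq p n) -
                  hitTime ω.1.1 ω.1.2 ω.2 (alphaSeq n)}).toReal)
      atTop (nhds 0) := by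
  have hpos : 0 < lambdaOf p := hcond.lambda_pos
  have hν : 0 < nuOf p - 1 := by linarith [hcond.two_le_nuOf]
  have hK : 0 < lambdaOf p / (nuOf p - 1) := div_pos hpos hν
  obtain ⟨C, hC⟩ : ∃ C : ℝ, 0 ≤ C ∧ ∀ n, (∑ i, (d n i : ℝ) ^ 2) ≤ C * n := by
    obtain ⟨C, hC⟩ := hcond.sq_bound
    exact ⟨max C 0, le_max_right _ _, fun n => (hC n).trans (by gcongr; exact le_max_left _ _)⟩
  obtain ⟨hC0, hC⟩ := hC
  set c := (nuOf p - 1) / (1 + ε / 2) with hc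
  have hc0 : 0 < c := by positivity
  have hcν : c < nuOf p - 1 := div_lt_self hν (by linarith)
  obtain ⟨θ', θ, hθ'0, hθ', hS⟩ := hcond.exists_laplace hc0 hcν
  set S := ∑' r : ℕ, (r : ℝ) * Real.exp (-(θ' * r)) * p r with hSdef
  have hS0 : 0 ≤ S := tsum_nonneg fun r => mul_nonneg (by positivity) (hcond.nonneg r)
  obtain ⟨l, hSl, hl⟩ := exists_between hS
  have hl0 : 0 < l := lt_of_le_of_lt (by positivity) hSl
  obtain ⟨l', hll', hl'⟩ := exists_between hl
  obtain ⟨κ, hκ, hκS⟩ : ∃ κ : ℝ, 0 < κ ∧ Real.exp (2 * θ + θ * c) * S < l * Real.exp (-κ) := by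
    refine ⟨(l - Real.exp (2 * θ + θ * c) * S) / (2 * l), div_pos (by linarith) (by linarith), ?_⟩
    refine lt_of_lt_of_le ?_ (mul_le_mul_of_nonneg_left (Real.one_sub_le_exp_neg _) hl0.le)
    have : l * ((l - Real.exp (2 * θ + θ * c) * S) / (2 * l)) =
        (l - Real.exp (2 * θ + θ * c) * S) / 2 := by field_simp
    linarith
  set ℓ := ⌈4 * (2 + ε) / ε⌉₊ with hℓ
  have hℓε : 4 * (2 + ε) ≤ ℓ * ε := by
    rw [← div_le_iff₀ hε]; exact Nat.le_ceil _
  set a := (1 + ε) / (2 + ε) with ha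
  have hℓa : 2 + (ℓ : ℝ) / 2 ≤ ℓ * a := by
    rw [ha, mul_div_assoc', le_div_iff₀ (by linarith)]
    linarith
  set K := C / l with hKdef
  have hK0 : 0 ≤ K := by positivity
  have hbound : ∀ᶠ n : ℕ in atTop, (n : ℝ) *
        ((((uniformGraph n (d n)).prod (weightMeasure n 1)).prod
              (uniformOn (Set.univ : Set (Fin n))))
            {ω | (1 + ε) * Real.log n / (2 * (nuOf p - 1)) ≤
                hitTime ω.1.1 ω.1.2 ω.2 (betaSeq p n) -
                  hitTime ω.1.1 ω.1.2 ω.2 (alphaSeq n)}).toReal ≤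
      2 * Real.exp (-1 * Real.log n) +
        K ^ 3 * Real.exp 9 * Real.exp (-(1 / 5) * Real.log n) := by
    set δ := min ((l' - l) / 3) (l * (θ - θ') / Real.exp (2 * θ)) with hδ
    have hδ0 : 0 < δ := lt_min (by linarith)
      (div_pos (mul_pos hl0 (by linarith)) (Real.exp_pos _))
    have hconv := (hcond.tendsto_sum_mul_exp_neg hθ'0).const_mul (Real.exp (2 * θ + θ * c))
    filter_upwards [eventually_gt_atTop 0, eventually_main_term_le p hK hℓa,
      eventually_growth_term_le p hK hκ (θ * c + κ), eventually_closed_term_le K hK0,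
      hconv.eventually_lt_const hκS, hcond.eventually_mul_le_sum hl',
      eventually_degree_bound hcond hδ0, eventually_sqrt_le p hK.le hC0 hδ0,
      eventually_alphaSeq_le_betaSeq p hK, tendsto_log_natCast.eventually_ge_atTop (ℓ + 5),
      eventually_le_exp_log (K * Real.exp 3) (show (0 : ℝ) < 2 / 5 by norm_num),
      eventually_le_exp_log (1 / l) (show (0 : ℝ) < 1 / 10 by norm_num),
      eventually_ceil_alphaSeq_le (show (0 : ℝ) < 1 / 20 by norm_num)]
      with n hn hmain hgrow hclosed hlap hsum hdeg hsqrt hαβ hlog hρ hη hceil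
    have hn0 : (0 : ℝ) < n := by exact_mod_cast hn
    have hℓ0 : (0 : ℝ) ≤ ℓ := Nat.cast_nonneg ℓ
    have hlog0 : 0 < Real.log n := by linarith
    have hM0 : 0 < l * n := by positivity
    have hδ₁ : δ * n ≤ (l' - l) / 3 * n := by gcongr; exact min_le_left _ _
    have hδ₂ : δ * n ≤ l * (θ - θ') / Real.exp (2 * θ) * n := by gcongr; exact min_le_right _ _
    have hℓα : ℓ < ⌈alphaSeq n⌉₊ := by
      rw [Nat.lt_ceil]
      have : Real.log n ≤ alphaSeq n := le_self_pow₀ (by linarith) (by norm_num)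
      linarith
    have hmeas := measure_event_le_explicit (d := d n) (fun v => hcond.three_le v)
      (s := (1 + ε) * Real.log n / (2 * (nuOf p - 1))) (M := l * n) (θ := θ) (κ := κ)
      (θ₂ := 2 / 5 * Real.log n) (ρ := K * Real.exp (3 - 2 / 5 * Real.log n))
      (hC n) hℓα hαβ hc0 (by positivity) hM0 (by linarith) (hθ'0.trans hθ').le hκ.le
      ?_ (by linarith) ?_ ?_ ?_
    · have hcs : c * ℓ * ((1 + ε) * Real.log n / (2 * (nuOf p - 1))) = ℓ * a * Real.log n := by
        rw [hc, ha]; field_simp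
      rw [hcs] at hmeas
      calc _ ≤ n * (Real.exp (-2 * Real.log n) + (Real.exp (-2 * Real.log n) +
            K ^ 3 * Real.exp 9 * Real.exp (-(6 / 5) * Real.log n))) := by
            refine mul_le_mul_of_nonneg_left (hmeas.trans ?_) hn0.le
            rw [mul_add (n : ℝ)]
            exact add_le_add hmain (add_le_add hgrow hclosed)
        _ = 2 * (Real.exp (Real.log n) * Real.exp (-2 * Real.log n)) + K ^ 3 * Real.exp 9 *
            (Real.exp (Real.log n) * Real.exp (-(6 / 5) * Real.log n)) := by
            rw [← natCast_eq_exp_log hn]; ring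
        _ = _ := by
            rw [← Real.exp_add, ← Real.exp_add]; ring_nf
    · refine (stepFactor_le_sum hM0 (θ' := θ') ?_).trans ?_
      · rw [div_le_iff₀ hM0]
        calc _ ≤ Real.exp (2 * θ) * (l * (θ - θ') / Real.exp (2 * θ) * n) := by
              gcongr; exact hsqrt.trans hδ₂
          _ = _ := by field_simp
      · rw [neg_add, Real.exp_add]
        rw [Real.exp_add] at hlap
        have h1 : Real.exp (-(θ * c)) * Real.exp (θ * c) = 1 := by
          rw [← Real.exp_add]; simp
        have h2 := mul_le_mul_of_nonneg_left hlap.le (Real.exp_pos (-(θ * c))).le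
        rw [div_mul_eq_mul_div, div_le_iff₀ hM0]
        have h3 := mul_le_mul_of_nonneg_right h2 hn0.le
        calc _ = (Real.exp (-(θ * c)) * Real.exp (θ * c)) * Real.exp (2 * θ) *
              ((∑ i, (d n i : ℝ) * Real.exp (-(θ' * d n i))) / n) * n := by
              rw [h1, one_mul, mul_assoc, div_mul_cancel₀ _ hn0.ne']
          _ ≤ _ := by linarith
    · rw [div_le_one hM0]
      have hη' : 1 ≤ Real.exp (1 / 10 * Real.log n) * l := by rwa [div_le_iff₀ hl0] at hη
      calc _ ≤ Real.exp (2 * (2 / 5 * Real.log n)) * Real.exp (1 / 20 * Real.log n) ^ 2 * 1 := by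
            rw [mul_one]; gcongr
        _ ≤ Real.exp (2 * (2 / 5 * Real.log n)) * Real.exp (1 / 20 * Real.log n) ^ 2 *
            (Real.exp (1 / 10 * Real.log n) * l) := by gcongr
        _ = l * (Real.exp (2 * (2 / 5 * Real.log n)) * Real.exp (2 * (1 / 20 * Real.log n)) *
            Real.exp (1 / 10 * Real.log n)) := by
            rw [← Real.exp_nat_mul]; push_cast; ring
        _ = l * n := by
            rw [← Real.exp_add, ← Real.exp_add]
            conv_rhs => rw [natCast_eq_exp_log hn]
            ring_nf
    · rw [hKdef, mul_div_mul_right _ _ hn0.ne']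
    · rw [Real.exp_sub, mul_div_assoc', div_le_one (Real.exp_pos _)]
      exact hρ
  refine squeeze_zero' (Eventually.of_forall fun n => by positivity) hbound ?_
  have h1 := (tendsto_exp_mul_log (show (-1 : ℝ) < 0 by norm_num)).const_mul 2
  have h2 := (tendsto_exp_mul_log (show -(1 / 5 : ℝ) < 0 by norm_num)).const_mul
    (K ^ 3 * Real.exp 9)
  simpa using h1.add h2

end Flooding
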